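/- arXiv:1910.13191 — 2 statements merged into one kernel-verified Lean document; each statement's English description precedes it below -/
import Mathlib

section
/- There exist constants c, C > 0 and ℓ₀ ∈ (0, 1/2) such that for every ℓ with 0 < ℓ < ℓ₀, the fourth-order structure function of Riemann's non-differentiable function satisfies c · ℓ³ · log(ℓ⁻¹) ≤ S₄(ℓ) ≤ C · ℓ³ · log(ℓ⁻¹). -/
open Real MeasureTheory

/-- `σ k = 1` if `k` is a perfect square, `0` otherwise. -/
noncomputable def sqIndicator (k : ℕ) : ℝ := if IsSquare k then 1 else 0

/-- The character `e_k(x) = e^{2πikx}`. -/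
noncomputable def eChar (k : ℕ) (x : ℝ) : ℂ :=
  Complex.exp (2 * Real.pi * Complex.I * (k : ℂ) * (x : ℂ))

/-- Riemann's non-differentiable function `R(x) = ∑_{k≥1} (σ_k/k) e^{2πikx}
    = ∑_{n≥1} e^{2πin²x}/n²`. -/
noncomputable def RiemannF (x : ℝ) : ℂ :=
  ∑' k : ℕ, ((sqIndicator k / k : ℝ) : ℂ) * eChar k x

/-- High-pass filter `R_{≥N}(x) = ∑_{k ≥ N} (σ_k/k) e^{2πikx}`. -/
noncomputable def RiemannHigh (N : ℕ) (x : ℝ) : ℂ :=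
  ∑' k : ℕ, if N ≤ k then ((sqIndicator k / k : ℝ) : ℂ) * eChar k x else 0

/-- The structure function `S_p(ℓ) = ∫₀¹ |R(x+ℓ) − R(x)|^p dx` (for natural `p`). -/
noncomputable def structureFn (p : ℕ) (ℓ : ℝ) : ℝ :=
  ∫ x in (0:ℝ)..1, ‖RiemannF (x + ℓ) - RiemannF x‖ ^ p

section SquaresEnergy

open Finset

/-- Pairs of pairs of integers in `[1, M]` with the same sum of squares. -/
def squareQuads (M : ℕ) : Finset ((ℕ × ℕ) × (ℕ × ℕ)) :=
  {q ∈ (Icc 1 M ×ˢ Icc 1 M) ×ˢ (Icc 1 M ×ˢ Icc 1 M) |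
    q.1.1 ^ 2 + q.1.2 ^ 2 = q.2.1 ^ 2 + q.2.2 ^ 2}

/-- Representations of `m` as a sum of two squares of integers in `[1, M]`. -/
def squareReps (M m : ℕ) : Finset (ℕ × ℕ) :=
  {p ∈ Icc 1 M ×ˢ Icc 1 M | p.1 ^ 2 + p.2 ^ 2 = m}

lemma sum_card_squareReps_sq (M : ℕ) (T : Finset ℕ) :
    ∑ m ∈ T, #(squareReps M m) ^ 2 = #{q ∈ squareQuads M | q.1.1 ^ 2 + q.1.2 ^ 2 ∈ T} := by
  have hmaps : Set.MapsTo (fun q : (ℕ × ℕ) × (ℕ × ℕ) => q.1.1 ^ 2 + q.1.2 ^ 2)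
      ↑{q ∈ squareQuads M | q.1.1 ^ 2 + q.1.2 ^ 2 ∈ T} ↑T := fun q hq => (mem_filter.1 hq).2
  rw [card_eq_sum_card_fiberwise hmaps]
  refine sum_congr rfl fun m hm => ?_
  rw [sq, ← card_product]
  congr 1
  ext ⟨⟨a, b⟩, c, d⟩
  simp only [squareReps, squareQuads, mem_product, mem_filter]
  constructor
  · rintro ⟨⟨h1, h2⟩, h3, h4⟩
    exact ⟨⟨⟨⟨h1, h3⟩, h2.trans h4.symm⟩, h2 ▸ hm⟩, h2⟩
  · rintro ⟨⟨⟨⟨h1, h3⟩, h⟩, h4⟩, h2⟩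
    exact ⟨⟨h1, h2⟩, h3, h ▸ h2⟩

lemma sum_card_squareReps_sq_le (M : ℕ) (T : Finset ℕ) :
    ∑ m ∈ T, #(squareReps M m) ^ 2 ≤ #(squareQuads M) := by
  rw [sum_card_squareReps_sq]
  exact card_filter_le _ _

lemma eq_and_eq_of_coprime_of_mul_eq {u v u' v' s s' : ℕ} (h : u.Coprime v) (h' : u'.Coprime v')
    (hs : 0 < s) (hs' : 0 < s') (hu : s * u = s' * u') (hv : s * v = s' * v') :
    s = s' ∧ u = u' ∧ v = v' := by
  have hss : s = s' := by
    calc s = Nat.gcd (s * u) (s * v) := by rw [Nat.gcd_mul_left, h.gcd_eq_one, mul_one]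
      _ = Nat.gcd (s' * u') (s' * v') := by rw [hu, hv]
      _ = s' := by rw [Nat.gcd_mul_left, h'.gcd_eq_one, mul_one]
  subst hss
  exact ⟨rfl, Nat.eq_of_mul_eq_mul_left hs hu, Nat.eq_of_mul_eq_mul_left hs hv⟩

lemma sum_totient_mul_sq_le_card_squareQuads (L : ℕ) :
    ∑ w ∈ Icc 1 L, w.totient * (L / w) ^ 2 ≤ #(squareQuads (6 * L)) := by
  have hcard : ∑ w ∈ Icc 1 L, w.totient * (L / w) ^ 2 =
      #((Icc 1 L).sigma fun w => {u ∈ range w | w.Coprime u} ×ˢ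
        (Ioc (L / w) (2 * (L / w)) ×ˢ Ioc (L / w) (2 * (L / w)))) := by
    rw [card_sigma]
    refine sum_congr rfl fun w _ => ?_
    rw [card_product, card_product, Nat.card_Ioc, Nat.totient_eq_card_coprime]
    have : 2 * (L / w) - L / w = L / w := by omega
    rw [this, sq]
  rw [hcard]
  have key : ∀ w u s t : ℕ, u < w → L / w < s → s ≤ 2 * (L / w) → L / w < t → t ≤ 2 * (L / w) →
      s * u < t * (u + w) ∧ t * (u + w) + s * u ≤ 6 * L := by
    intro w u s t hu hs hs' ht ht'
    have h1 : L / w * w ≤ L := Nat.div_mul_le_self L w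
    constructor
    · have : s * u ≤ (2 * t) * u := Nat.mul_le_mul_right _ (by omega)
      nlinarith
    · have h2 : t * (u + w) ≤ 2 * (L / w) * (2 * w) := Nat.mul_le_mul ht' (by omega)
      have h3 : s * u ≤ 2 * (L / w) * w := Nat.mul_le_mul hs' hu.le
      nlinarith
  refine card_le_card_of_injOn (fun x : (_ : ℕ) × ℕ × ℕ × ℕ =>
    ((x.2.2.2 * (x.2.1 + x.1) + x.2.2.1 * x.2.1, x.2.2.1 * (x.2.1 + x.1) - x.2.2.2 * x.2.1),
     (x.2.2.2 * (x.2.1 + x.1) - x.2.2.1 * x.2.1, x.2.2.1 * (x.2.1 + x.1) + x.2.2.2 * x.2.1)))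
    ?_ ?_
  · rintro ⟨w, u, s, t⟩ hx
    simp only [coe_sigma, Set.mem_sigma_iff, mem_coe, mem_product, mem_filter, mem_range, mem_Ioc,
      mem_Icc] at hx
    obtain ⟨-, ⟨hu, -⟩, ⟨hs, hs'⟩, ht, ht'⟩ := hx
    obtain ⟨h1, h2⟩ := key w u s t hu hs hs' ht ht'
    obtain ⟨h3, h4⟩ := key w u t s hu ht ht' hs hs'
    simp only [squareQuads, coe_filter, Set.mem_ofPred_eq, mem_product, mem_Icc]
    refine ⟨by omega, ?_⟩
    zify [h1.le, h3.le]
    ring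
  · rintro ⟨w, u, s, t⟩ hx ⟨w', u', s', t'⟩ hx' h
    simp only [coe_sigma, Set.mem_sigma_iff, mem_coe, mem_product, mem_filter, mem_range, mem_Ioc,
      mem_Icc] at hx hx'
    obtain ⟨-, ⟨hu, hc⟩, ⟨hs, hs'⟩, ht, ht'⟩ := hx
    obtain ⟨-, ⟨hu', hc'⟩, ⟨hs1, hs1'⟩, ht1, ht1'⟩ := hx'
    obtain ⟨h1, h2⟩ := key w u s t hu hs hs' ht ht'
    obtain ⟨h3, h4⟩ := key w u t s hu ht ht' hs hs'
    obtain ⟨h5, h6⟩ := key w' u' s' t' hu' hs1 hs1' ht1 ht1'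
    obtain ⟨h7, h8⟩ := key w' u' t' s' hu' ht1 ht1' hs1 hs1'
    simp only [Prod.mk.injEq] at h
    have e1 : s * u = s' * u' := by omega
    have e2 : s * (u + w) = s' * (u' + w') := by omega
    have e3 : t * (u + w) = t' * (u' + w') := by omega
    obtain ⟨rfl, rfl, hw⟩ := eq_and_eq_of_coprime_of_mul_eq
      (show u.Coprime (u + w) by simpa using hc.symm)
      (show u'.Coprime (u' + w') by simpa using hc'.symm) (by omega) (by omega) e1 e2
    obtain rfl : w = w' := by omega
    obtain rfl : t = t' := Nat.eq_of_mul_eq_mul_right (by omega) e3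
    rfl

lemma sum_inv_sq_Icc_le (L : ℕ) : ∑ k ∈ Icc 1 L, ((k : ℝ) ^ 2)⁻¹ ≤ 2 := by
  have h : ∀ n : ℕ, ∑ k ∈ Icc 1 (n + 1), ((k : ℝ) ^ 2)⁻¹ ≤ 2 - ((n : ℝ) + 1)⁻¹ := by
    intro n
    induction n with
    | zero => norm_num
    | succ n ih =>
      rw [sum_Icc_succ_top (by omega)]
      push_cast
      have h2 : ((n : ℝ) + 1)⁻¹ - ((n : ℝ) + 1 + 1)⁻¹ - (((n : ℝ) + 1 + 1) ^ 2)⁻¹ =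
          (((n : ℝ) + 1 + 1) ^ 2 * (n + 1))⁻¹ := by
        field_simp
        ring
      have h3 : 0 ≤ (((n : ℝ) + 1 + 1) ^ 2 * (n + 1))⁻¹ := by positivity
      linarith
  cases L with
  | zero => simp
  | succ n =>
    have h2 : (0 : ℝ) ≤ ((n : ℝ) + 1)⁻¹ := by positivity
    linarith [h n]

lemma log_le_two_mul_sum_totient_div_sq (L : ℕ) :
    Real.log (L + 1) ≤ 2 * ∑ w ∈ Icc 1 L, (w.totient : ℝ) / (w : ℝ) ^ 2 := by
  have h1 : ∑ n ∈ Icc 1 L, ((n : ℝ))⁻¹ ≤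
      (∑ w ∈ Icc 1 L, (w.totient : ℝ) / (w : ℝ) ^ 2) * ∑ k ∈ Icc 1 L, ((k : ℝ) ^ 2)⁻¹ := by
    have h2 : ∀ n ∈ Icc 1 L, ((n : ℝ))⁻¹ = ∑ p ∈ Icc 1 L ×ˢ Icc 1 L with p.1 * p.2 = n,
        (p.1.totient : ℝ) / (p.1 : ℝ) ^ 2 * ((p.2 : ℝ) ^ 2)⁻¹ := by
      intro n hn
      rw [mem_Icc] at hn
      have h3 : {p ∈ Icc 1 L ×ˢ Icc 1 L | p.1 * p.2 = n} = n.divisorsAntidiagonal := by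
        ext ⟨a, b⟩
        simp only [mem_filter, mem_product, mem_Icc, Nat.mem_divisorsAntidiagonal]
        constructor
        · rintro ⟨-, h⟩
          exact ⟨h, by omega⟩
        · rintro ⟨rfl, h⟩
          have ha : 0 < a := Nat.pos_of_ne_zero fun h0 => h (by simp [h0])
          have hb : 0 < b := Nat.pos_of_ne_zero fun h0 => h (by simp [h0])
          refine ⟨⟨⟨ha, ?_⟩, hb, ?_⟩, rfl⟩ <;> nlinarith
      have hn0 : (n : ℝ) ≠ 0 := by exact_mod_cast (by omega : n ≠ 0)
      calc ((n : ℝ))⁻¹ = (∑ d ∈ n.divisors, (d.totient : ℝ)) / (n : ℝ) ^ 2 := by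
            rw [← Nat.cast_sum, Nat.sum_totient]
            field_simp
        _ = ∑ p ∈ n.divisorsAntidiagonal, (p.1.totient : ℝ) / (n : ℝ) ^ 2 := by
            rw [sum_div, Nat.sum_divisorsAntidiagonal (fun a _ => (a.totient : ℝ) / (n : ℝ) ^ 2)]
        _ = _ := by
            rw [h3]
            refine sum_congr rfl fun p hp => ?_
            rw [← (Nat.mem_divisorsAntidiagonal.1 hp).1]
            push_cast
            rw [mul_pow, div_mul_eq_div_div, div_eq_mul_inv (_ / _)]
    rw [sum_congr rfl h2, sum_mul_sum, ← sum_product']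
    calc _ = ∑ p ∈ Icc 1 L ×ˢ Icc 1 L with p.1 * p.2 ∈ Icc 1 L,
          (p.1.totient : ℝ) / (p.1 : ℝ) ^ 2 * ((p.2 : ℝ) ^ 2)⁻¹ := by
          rw [← sum_fiberwise_of_maps_to (t := Icc 1 L) (g := fun p : ℕ × ℕ => p.1 * p.2)
            (fun p hp => (mem_filter.1 hp).2)]
          refine sum_congr rfl fun n hn => sum_congr ?_ fun _ _ => rfl
          ext p
          simp only [mem_filter]
          constructor
          · rintro ⟨h, h'⟩
            exact ⟨⟨h, h' ▸ hn⟩, h'⟩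
          · rintro ⟨⟨h, -⟩, h'⟩
            exact ⟨h, h'⟩
      _ ≤ _ := sum_le_sum_of_subset_of_nonneg (filter_subset _ _) fun _ _ _ => by positivity
  have h2 := log_add_one_le_harmonic L
  rw [harmonic_eq_sum_Icc] at h2
  push_cast at h2
  have h3 := sum_inv_sq_Icc_le L
  have h4 : 0 ≤ ∑ w ∈ Icc 1 L, (w.totient : ℝ) / (w : ℝ) ^ 2 :=
    sum_nonneg fun _ _ => by positivity
  nlinarith

/-- Lower bound for the additive energy of the squares. -/
lemma sq_mul_log_le_card_squareQuads (L : ℕ) :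
    (L : ℝ) ^ 2 * Real.log (L + 1) / 8 ≤ #(squareQuads (6 * L)) := by
  have h1 : (∑ w ∈ Icc 1 L, (w.totient : ℝ) * ((L / w : ℕ) : ℝ) ^ 2) ≤ #(squareQuads (6 * L)) := by
    exact_mod_cast sum_totient_mul_sq_le_card_squareQuads L
  have h2 : (L : ℝ) ^ 2 / 4 * ∑ w ∈ Icc 1 L, (w.totient : ℝ) / (w : ℝ) ^ 2 ≤
      ∑ w ∈ Icc 1 L, (w.totient : ℝ) * ((L / w : ℕ) : ℝ) ^ 2 := by
    rw [mul_sum]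
    refine sum_le_sum fun w hw => ?_
    rw [mem_Icc] at hw
    have hw0 : (0 : ℝ) < w := by exact_mod_cast hw.1
    have h3 : (L : ℝ) / (2 * w) ≤ ((L / w : ℕ) : ℝ) := by
      rw [div_le_iff₀ (by positivity)]
      have h4 : 1 ≤ L / w := (Nat.one_le_div_iff hw.1).2 hw.2
      have h5 := Nat.div_add_mod L w
      have h6 := Nat.mod_lt L hw.1
      have : L ≤ L / w * (2 * w) := by nlinarith
      exact_mod_cast this
    calc (L : ℝ) ^ 2 / 4 * ((w.totient : ℝ) / (w : ℝ) ^ 2)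
        = (w.totient : ℝ) * ((L : ℝ) / (2 * w)) ^ 2 := by field_simp; ring
      _ ≤ _ := by gcongr
  have h3 := log_le_two_mul_sum_totient_div_sq L
  nlinarith [sq_nonneg (L : ℝ)]

end SquaresEnergy

section SquaresEnergyUpper

open Finset

lemma card_sigma_Icc_div_max_le (L : ℕ) :
    (#((Icc 1 L ×ˢ Icc 1 L).sigma fun p : ℕ × ℕ =>
      Icc 1 (L / max p.1 p.2) ×ˢ Icc 1 (L / max p.1 p.2)) : ℝ) ≤
      2 * (L : ℝ) ^ 2 * (1 + Real.log L) := by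
  have h1 : (#((Icc 1 L ×ˢ Icc 1 L).sigma fun p : ℕ × ℕ =>
      Icc 1 (L / max p.1 p.2) ×ˢ Icc 1 (L / max p.1 p.2)) : ℝ) ≤
      ∑ p ∈ Icc 1 L ×ˢ Icc 1 L, ((if p.1 ≤ p.2 then ((L : ℝ) / p.2) ^ 2 else 0) +
        if p.2 ≤ p.1 then ((L : ℝ) / p.1) ^ 2 else 0) := by
    rw [card_sigma]
    push_cast
    refine sum_le_sum fun p _ => ?_
    rw [card_product, Nat.card_Icc, Nat.add_sub_cancel]
    push_cast
    rw [← sq]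
    rcases le_total p.1 p.2 with h | h
    · rw [max_eq_right h, if_pos h]
      have : (((L / p.2 : ℕ) : ℝ)) ^ 2 ≤ ((L : ℝ) / p.2) ^ 2 := by
        gcongr
        exact Nat.cast_div_le
      have h2 : (0 : ℝ) ≤ if p.2 ≤ p.1 then ((L : ℝ) / p.1) ^ 2 else 0 := by positivity
      linarith
    · rw [max_eq_left h, if_pos h]
      have : (((L / p.1 : ℕ) : ℝ)) ^ 2 ≤ ((L : ℝ) / p.1) ^ 2 := by
        gcongr
        exact Nat.cast_div_le
      have h2 : (0 : ℝ) ≤ if p.1 ≤ p.2 then ((L : ℝ) / p.2) ^ 2 else 0 := by positivity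
      linarith
  have h2 : ∀ v ∈ Icc 1 L, ∑ u ∈ Icc 1 L, (if u ≤ v then ((L : ℝ) / v) ^ 2 else 0) =
      (L : ℝ) ^ 2 * ((v : ℝ))⁻¹ := by
    intro v hv
    rw [mem_Icc] at hv
    have hv0 : (v : ℝ) ≠ 0 := by exact_mod_cast (by omega : v ≠ 0)
    rw [← sum_filter, sum_const]
    have : {u ∈ Icc 1 L | u ≤ v} = Icc 1 v := by
      ext u
      simp only [mem_filter, mem_Icc]
      omega
    rw [this, Nat.card_Icc, Nat.add_sub_cancel, nsmul_eq_mul]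
    field_simp
  rw [sum_add_distrib, sum_product_right, sum_product, sum_congr rfl h2, ← mul_sum] at h1
  have h3 := harmonic_le_one_add_log L
  rw [harmonic_eq_sum_Icc] at h3
  push_cast at h3
  nlinarith [sq_nonneg (L : ℝ)]

lemma exists_factorization_of_mul_eq_mul {a b c d : ℕ} (ha : 0 < a) (hc : 0 < c)
    (h : a * b = c * d) : ∃ u v g t : ℕ, a = g * u ∧ b = v * t ∧ c = g * v ∧ d = u * t := by
  obtain ⟨u, v, huv, hu, hv⟩ := Nat.exists_coprime a c
  have hg : 0 < a.gcd c := Nat.gcd_pos_of_pos_left _ ha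
  set g := a.gcd c
  have h1 : u * b = v * d := by
    refine Nat.eq_of_mul_eq_mul_left hg ?_
    calc g * (u * b) = (u * g) * b := by ring
      _ = (v * g) * d := by rw [← hu, ← hv, h]
      _ = _ := by ring
  have h2 : v ∣ b := huv.symm.dvd_of_dvd_mul_left ⟨d, h1⟩
  obtain ⟨t, rfl⟩ := h2
  refine ⟨u, v, g, t, by rw [hu, mul_comm], rfl, by rw [hv, mul_comm], ?_⟩
  have hv0 : 0 < v := Nat.pos_of_ne_zero fun h0 => by simp [h0] at hv; omega
  refine Nat.eq_of_mul_eq_mul_left hv0 ?_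
  rw [← h1]
  ring

lemma card_squareQuads_filter_lt_le (M : ℕ) :
    #{q ∈ squareQuads M | q.2.1 < q.1.1} ≤
      #((Icc 1 (2 * M) ×ˢ Icc 1 (2 * M)).sigma fun p : ℕ × ℕ =>
        Icc 1 (2 * M / max p.1 p.2) ×ˢ Icc 1 (2 * M / max p.1 p.2)) := by
  refine (card_le_card ?_).trans (card_image_le (f := fun x : (_ : ℕ × ℕ) × (ℕ × ℕ) =>
    (((x.2.1 * x.1.1 + x.1.2 * x.2.2) / 2, (x.1.1 * x.2.2 - x.2.1 * x.1.2) / 2),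
     ((x.1.2 * x.2.2 - x.2.1 * x.1.1) / 2, (x.1.1 * x.2.2 + x.2.1 * x.1.2) / 2))))
  rintro ⟨⟨n₁, n₂⟩, n₃, n₄⟩ hq
  simp only [squareQuads, mem_filter, mem_product, mem_Icc] at hq
  obtain ⟨⟨⟨⟨h1, h2⟩, h3, h4⟩, he⟩, hlt⟩ := hq
  have hlt' : n₂ < n₄ := by
    by_contra! hle
    nlinarith
  obtain ⟨a, rfl⟩ := Nat.exists_eq_add_of_lt hlt
  obtain ⟨c, rfl⟩ := Nat.exists_eq_add_of_lt hlt'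
  obtain ⟨u, v, g, t, ha, hb, hc, hd⟩ := exists_factorization_of_mul_eq_mul
    (a := a + 1) (b := 2 * n₃ + a + 1) (c := c + 1) (d := 2 * n₂ + c + 1)
    (by omega) (by omega) (by nlinarith)
  have hu : 0 < u := Nat.pos_of_ne_zero fun h0 => by simp [h0] at ha
  have hv : 0 < v := Nat.pos_of_ne_zero fun h0 => by simp [h0] at hc
  have hg : 0 < g := Nat.pos_of_ne_zero fun h0 => by simp [h0] at hc
  have ht : 0 < t := Nat.pos_of_ne_zero fun h0 => by simp [h0] at hd
  have hg' : g * max u v ≤ 2 * M := by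
    rcases max_choice u v with h | h <;> rw [h] <;> omega
  have ht' : t * max u v ≤ 2 * M := by
    rcases max_choice u v with h | h <;> rw [h, mul_comm] <;> omega
  have hm : 0 < max u v := lt_max_of_lt_left hu
  refine mem_image.2 ⟨⟨(u, v), (g, t)⟩, ?_, ?_⟩
  · simp only [mem_sigma, mem_product, mem_Icc, Nat.le_div_iff_mul_le hm]
    refine ⟨⟨⟨hu, ?_⟩, hv, ?_⟩, ⟨hg, hg'⟩, ht, ht'⟩
    · exact (le_max_left u v).trans ((Nat.le_mul_of_pos_left _ hg).trans hg')
    · exact (le_max_right u v).trans ((Nat.le_mul_of_pos_left _ hg).trans hg')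
  · simp only [Prod.mk.injEq, ← ha, ← hb, ← hc, ← hd]
    omega

/-- Upper bound for the additive energy of the squares. -/
lemma card_squareQuads_le {M : ℕ} (hM : 1 ≤ M) :
    (#(squareQuads M) : ℝ) ≤ 40 * (M : ℝ) ^ 2 * (1 + Real.log M) := by
  have hdiag : #{q ∈ squareQuads M | q.1.1 = q.2.1} ≤ M ^ 2 := by
    have : #(Icc 1 M ×ˢ Icc 1 M) = M ^ 2 := by simp [sq]
    rw [← this]
    refine card_le_card_of_injOn (fun q => q.1) ?_ ?_
    · intro q hq
      simp only [squareQuads, coe_filter, mem_filter, mem_product, Set.mem_ofPred_eq] at hq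
      exact mem_coe.2 (mem_product.2 hq.1.1.1)
    · rintro ⟨⟨a, b⟩, c, d⟩ hq ⟨⟨a', b'⟩, c', d'⟩ hq' h
      simp only [squareQuads, coe_filter, mem_filter, mem_product, Set.mem_ofPred_eq] at hq hq'
      simp only [Prod.mk.injEq] at h
      obtain ⟨rfl, rfl⟩ := h
      obtain ⟨⟨-, h1⟩, rfl⟩ := hq
      obtain ⟨⟨-, h2⟩, rfl⟩ := hq'
      have h3 : b = d := by nlinarith
      have h4 : b = d' := by nlinarith
      rw [← h3, ← h4]
  have hswap : #{q ∈ squareQuads M | q.1.1 < q.2.1} ≤ #{q ∈ squareQuads M | q.2.1 < q.1.1} := by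
    refine card_le_card_of_injOn Prod.swap ?_ Prod.swap_injective.injOn
    intro q hq
    simp only [squareQuads, coe_filter, mem_filter, mem_product, Set.mem_ofPred_eq, Prod.fst_swap,
      Prod.snd_swap] at hq ⊢
    exact ⟨⟨⟨hq.1.1.2, hq.1.1.1⟩, hq.1.2.symm⟩, hq.2⟩
  have hsplit : #(squareQuads M) ≤ #{q ∈ squareQuads M | q.1.1 = q.2.1} +
      #{q ∈ squareQuads M | q.1.1 < q.2.1} + #{q ∈ squareQuads M | q.2.1 < q.1.1} := by
    refine (card_le_card ?_).trans ((card_union_le _ _).trans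
      (Nat.add_le_add_right (card_union_le _ _) _))
    intro q hq
    simp only [mem_union, mem_filter, hq, true_and]
    rcases lt_trichotomy q.1.1 q.2.1 with h | h | h <;> simp [h]
  have hlt := card_squareQuads_filter_lt_le M
  have h1 : (#(squareQuads M) : ℝ) ≤ (M : ℝ) ^ 2 +
      2 * (2 * ((2 * M : ℕ) : ℝ) ^ 2 * (1 + Real.log ((2 * M : ℕ) : ℝ))) := by
    have h2 := card_sigma_Icc_div_max_le (2 * M)
    have h3 : (#(squareQuads M) : ℝ) ≤ (M : ℝ) ^ 2 +
        2 * #((Icc 1 (2 * M) ×ˢ Icc 1 (2 * M)).sigma fun p : ℕ × ℕ =>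
          Icc 1 (2 * M / max p.1 p.2) ×ˢ Icc 1 (2 * M / max p.1 p.2)) := by
      exact_mod_cast (by omega)
    linarith
  have hM' : (1 : ℝ) ≤ M := by exact_mod_cast hM
  have hlog : 0 ≤ Real.log M := Real.log_nonneg hM'
  push_cast at h1
  rw [Real.log_mul (by norm_num) (by positivity)] at h1
  have hl2 : Real.log 2 ≤ 0.7 := by linarith [Real.log_two_lt_d9]
  nlinarith [mul_nonneg (sq_nonneg (M : ℝ)) hlog, mul_le_mul_of_nonneg_left hl2 (sq_nonneg (M : ℝ))]

end SquaresEnergyUpper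

section IncrementSeries

open Finset Filter Topology

lemma eChar_add_left (j k : ℕ) (x : ℝ) : eChar (j + k) x = eChar j x * eChar k x := by
  rw [eChar, eChar, eChar, ← Complex.exp_add]
  push_cast
  ring_nf

lemma eChar_add_right (k : ℕ) (x y : ℝ) : eChar k (x + y) = eChar k x * eChar k y := by
  rw [eChar, eChar, eChar, ← Complex.exp_add]
  push_cast
  ring_nf

lemma eChar_eq_exp_I_mul (k : ℕ) (x : ℝ) :
    eChar k x = Complex.exp (Complex.I * ((2 * π * k * x : ℝ) : ℂ)) := by
  rw [eChar]
  push_cast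
  ring_nf

lemma norm_eChar (k : ℕ) (x : ℝ) : ‖eChar k x‖ = 1 := by
  rw [eChar_eq_exp_I_mul, mul_comm, Complex.norm_exp_ofReal_mul_I]

lemma continuous_eChar (k : ℕ) : Continuous (eChar k) := by
  unfold eChar
  fun_prop

lemma integral_eChar_mul_conj (j k : ℕ) :
    ∫ x in (0 : ℝ)..1, eChar j x * (starRingEnd ℂ) (eChar k x) = if j = k then 1 else 0 := by
  split_ifs with h
  · subst h
    simp [Complex.mul_conj, Complex.normSq_eq_norm_sq, norm_eChar]
  · have h1 : ∀ x : ℝ, eChar j x * (starRingEnd ℂ) (eChar k x) =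
        Complex.exp ((2 * π * Complex.I * ((j : ℂ) - k)) * x) := by
      intro x
      rw [eChar, eChar, ← Complex.exp_conj, ← Complex.exp_add]
      congr 1
      simp only [map_mul, map_ofNat, Complex.conj_ofReal, Complex.conj_I, map_natCast]
      ring
    have hjk : (j : ℂ) - k ≠ 0 := sub_ne_zero.2 (by exact_mod_cast h)
    have hc : 2 * π * Complex.I * ((j : ℂ) - k) ≠ 0 := mul_ne_zero Complex.two_pi_I_ne_zero hjk
    simp_rw [h1]
    rw [integral_exp_mul_complex hc]
    have h2 : Complex.exp (2 * π * Complex.I * ((j : ℂ) - k) * (1 : ℝ)) = 1 := by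
      rw [Complex.exp_eq_one_iff]
      exact ⟨(j : ℤ) - k, by push_cast; ring⟩
    rw [h2]
    simp

/-- Parseval's identity for trigonometric polynomials. -/
lemma integral_norm_sq_sum_mul_eChar (T : Finset ℕ) (c : ℕ → ℂ) :
    ∫ x in (0 : ℝ)..1, ‖∑ m ∈ T, c m * eChar m x‖ ^ 2 = ∑ m ∈ T, ‖c m‖ ^ 2 := by
  have h1 : ∀ x : ℝ, ((‖∑ m ∈ T, c m * eChar m x‖ ^ 2 : ℝ) : ℂ) =
      ∑ j ∈ T, ∑ k ∈ T, c j * (starRingEnd ℂ) (c k) *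
        (eChar j x * (starRingEnd ℂ) (eChar k x)) := by
    intro x
    rw [← Complex.normSq_eq_norm_sq, ← Complex.mul_conj, map_sum, sum_mul_sum]
    refine sum_congr rfl fun j _ => sum_congr rfl fun k _ => ?_
    rw [map_mul]
    ring
  have hcont : ∀ j k, Continuous fun x => c j * (starRingEnd ℂ) (c k) *
        (eChar j x * (starRingEnd ℂ) (eChar k x)) := fun j k =>
    continuous_const.mul ((continuous_eChar j).mul (Complex.continuous_conj.comp (continuous_eChar k)))
  apply Complex.ofReal_injective
  rw [← intervalIntegral.integral_ofReal]
  simp_rw [h1]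
  rw [intervalIntegral.integral_finsetSum fun j _ =>
    (continuous_finsetSum _ fun k _ => hcont j k).intervalIntegrable _ _]
  push_cast
  refine sum_congr rfl fun j hj => ?_
  rw [intervalIntegral.integral_finsetSum fun k _ => (hcont j k).intervalIntegrable _ _]
  simp_rw [intervalIntegral.integral_const_mul, integral_eChar_mul_conj]
  simp [hj, Complex.mul_conj, Complex.normSq_eq_norm_sq]

lemma integral_norm_pow_four_sum_mul_eChar_sq (P : Finset ℕ) (a : ℕ → ℂ) (T : Finset ℕ)
    (hT : ∀ p ∈ P ×ˢ P, p.1 ^ 2 + p.2 ^ 2 ∈ T) :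
    ∫ x in (0 : ℝ)..1, ‖∑ n ∈ P, a n * eChar (n ^ 2) x‖ ^ 4 =
      ∑ m ∈ T, ‖∑ p ∈ P ×ˢ P with p.1 ^ 2 + p.2 ^ 2 = m, a p.1 * a p.2‖ ^ 2 := by
  rw [← integral_norm_sq_sum_mul_eChar]
  congr 1
  ext x
  have h : (∑ n ∈ P, a n * eChar (n ^ 2) x) ^ 2 =
      ∑ m ∈ T, (∑ p ∈ P ×ˢ P with p.1 ^ 2 + p.2 ^ 2 = m, a p.1 * a p.2) * eChar m x := by
    rw [sq, sum_mul_sum, ← sum_product', ← sum_fiberwise_of_maps_to hT]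
    refine sum_congr rfl fun m _ => ?_
    rw [sum_mul]
    refine sum_congr rfl fun p hp => ?_
    rw [← (mem_filter.1 hp).2, eChar_add_left]
    ring
  rw [← h, norm_pow]
  ring

lemma summable_inv_sq_mul_eChar (x : ℝ) :
    Summable fun n : ℕ => ((n : ℂ) ^ 2)⁻¹ * eChar (n ^ 2) x := by
  refine Summable.of_norm_bounded (Real.summable_nat_pow_inv.2 (by norm_num : 1 < 2)) fun n => ?_
  rw [norm_mul, norm_eChar, norm_inv, norm_pow, Complex.norm_natCast, mul_one]

lemma hasSum_RiemannF (x : ℝ) :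
    HasSum (fun n : ℕ => ((n : ℂ) ^ 2)⁻¹ * eChar (n ^ 2) x) (RiemannF x) := by
  have hinj : Function.Injective fun n : ℕ => n ^ 2 := Nat.pow_left_injective (by norm_num)
  have h : RiemannF x = ∑' n : ℕ, ((n : ℂ) ^ 2)⁻¹ * eChar (n ^ 2) x := by
    rw [RiemannF, ← hinj.tsum_eq (f := fun k : ℕ => ((sqIndicator k / k : ℝ) : ℂ) * eChar k x)]
    · refine tsum_congr fun n => ?_
      simp [sqIndicator, IsSquare.sq]
    · intro k hk
      by_contra hk'
      refine hk ?_
      have : ¬ IsSquare k := fun ⟨r, hr⟩ => hk' ⟨r, by simp [hr, sq]⟩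
      simp [sqIndicator, this]
  rw [h]
  exact (summable_inv_sq_mul_eChar x).hasSum

/-- The coefficient of `e^{2πin²x}` in `R(x + ℓ) − R(x)`. -/
noncomputable def incrementCoeff (ℓ : ℝ) (n : ℕ) : ℂ := (eChar (n ^ 2) ℓ - 1) / (n : ℂ) ^ 2

lemma hasSum_increment (ℓ x : ℝ) :
    HasSum (fun n : ℕ => incrementCoeff ℓ n * eChar (n ^ 2) x)
      (RiemannF (x + ℓ) - RiemannF x) := by
  refine ((hasSum_RiemannF (x + ℓ)).sub (hasSum_RiemannF x)).congr_fun fun n => ?_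
  simp only [incrementCoeff, eChar_add_right]
  ring

lemma norm_incrementCoeff_le (ℓ : ℝ) (n : ℕ) : ‖incrementCoeff ℓ n‖ ≤ 2 / (n : ℝ) ^ 2 := by
  rw [incrementCoeff, norm_div, norm_pow, Complex.norm_natCast]
  gcongr
  refine (norm_sub_le _ _).trans ?_
  rw [norm_eChar, norm_one]
  norm_num

lemma norm_incrementCoeff_le_mul {ℓ : ℝ} (hℓ : 0 ≤ ℓ) (n : ℕ) :
    ‖incrementCoeff ℓ n‖ ≤ 8 * ℓ := by
  rcases Nat.eq_zero_or_pos n with rfl | hn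
  · simpa [incrementCoeff] using hℓ
  have hn' : (0 : ℝ) < n := by exact_mod_cast hn
  rw [incrementCoeff, norm_div, norm_pow, Complex.norm_natCast, div_le_iff₀ (by positivity),
    eChar_eq_exp_I_mul]
  refine Real.norm_exp_I_mul_ofReal_sub_one_le.trans ?_
  rw [Real.norm_of_nonneg (by positivity)]
  push_cast
  have : 2 * π ≤ 8 := by linarith [Real.pi_lt_four]
  calc 2 * π * (n : ℝ) ^ 2 * ℓ ≤ 8 * (n : ℝ) ^ 2 * ℓ := by gcongr
    _ = _ := by ring

lemma tendsto_integral_partialSum_pow_four (ℓ : ℝ) :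
    Tendsto (fun K : ℕ => ∫ x in (0 : ℝ)..1,
        ‖∑ n ∈ Icc 1 K, incrementCoeff ℓ n * eChar (n ^ 2) x‖ ^ 4) atTop
      (𝓝 (structureFn 4 ℓ)) := by
  have hsum : Summable fun n : ℕ => 2 / (n : ℝ) ^ 2 := by
    simpa [div_eq_mul_inv] using
      (Real.summable_nat_pow_inv.2 (by norm_num : 1 < 2)).mul_left (2 : ℝ)
  refine intervalIntegral.tendsto_integral_filter_of_dominated_convergence
    (fun _ => (∑' n : ℕ, 2 / (n : ℝ) ^ 2) ^ 4) ?_ ?_ intervalIntegrable_const ?_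
  · refine Eventually.of_forall fun K => Continuous.aestronglyMeasurable ?_
    exact ((continuous_finsetSum _ fun n _ =>
      continuous_const.mul (continuous_eChar (n ^ 2))).norm).pow 4
  · refine Eventually.of_forall fun K => Eventually.of_forall fun x _ => ?_
    rw [Real.norm_of_nonneg (by positivity)]
    gcongr
    refine (norm_sum_le _ _).trans ?_
    refine le_trans (sum_le_sum fun n _ => ?_) (hsum.sum_le_tsum (Icc 1 K) fun _ _ => by positivity)
    rw [norm_mul, norm_eChar, mul_one]
    exact norm_incrementCoeff_le ℓ n
  · refine Eventually.of_forall fun x _ => ?_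
    refine Tendsto.pow (Tendsto.norm ?_) 4
    have h := (hasSum_increment ℓ x).tendsto_sum_nat.comp (tendsto_add_atTop_nat 1)
    refine h.congr fun K => ?_
    simp only [Function.comp_apply]
    rw [range_eq_Ico, sum_eq_sum_Ico_succ_bot (by omega)]
    simp only [incrementCoeff, Nat.cast_zero, ne_eq, OfNat.ofNat_ne_zero, not_false_eq_true,
      zero_pow, div_zero, zero_mul, zero_add]
    rfl

lemma re_exp_sub_one_mul_exp_sub_one_le {s t : ℝ} (hs : 0 < s) (hs' : s ≤ 1 / 2) (ht : 0 < t)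
    (ht' : t ≤ 1 / 2) :
    ((Complex.exp (Complex.I * s) - 1) * (Complex.exp (Complex.I * t) - 1)).re ≤ -(s * t) / 8 := by
  have hsin : ∀ r : ℝ, 0 < r → r ≤ 1 / 2 → r / 2 ≤ Real.sin r := by
    intro r h0 h1
    have := Real.sin_gt_sub_cube h0
    nlinarith [mul_pos h0 h0]
  have hcos : ∀ r : ℝ, 0 < r → r ≤ 1 / 2 → 1 - Real.cos r ≤ r / 4 := by
    intro r h0 h1
    have := Real.one_sub_sq_div_two_le_cos (x := r)
    nlinarith
  have h : ((Complex.exp (Complex.I * s) - 1) * (Complex.exp (Complex.I * t) - 1)).re =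
      (1 - Real.cos s) * (1 - Real.cos t) - Real.sin s * Real.sin t := by
    rw [mul_comm Complex.I, mul_comm Complex.I, Complex.exp_mul_I, Complex.exp_mul_I,
      ← Complex.ofReal_cos, ← Complex.ofReal_sin, ← Complex.ofReal_cos, ← Complex.ofReal_sin]
    simp [Complex.cos_ofReal_re, Complex.sin_ofReal_re]
    ring
  rw [h]
  have h1 : (1 - Real.cos s) * (1 - Real.cos t) ≤ s / 4 * (t / 4) :=
    mul_le_mul (hcos s hs hs') (hcos t ht ht') (by linarith [Real.cos_le_one t]) (by positivity)
  have h2 : s / 2 * (t / 2) ≤ Real.sin s * Real.sin t :=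
    mul_le_mul (hsin s hs hs') (hsin t ht ht') (by positivity)
      ((by positivity : 0 ≤ s / 2).trans (hsin s hs hs'))
  nlinarith [mul_pos hs ht]

lemma re_incrementCoeff_mul_le {ℓ : ℝ} (hℓ : 0 < ℓ) {n k : ℕ} (hn : 0 < n) (hk : 0 < k)
    (hn' : 16 * (n : ℝ) ^ 2 * ℓ ≤ 1) (hk' : 16 * (k : ℝ) ^ 2 * ℓ ≤ 1) :
    (incrementCoeff ℓ n * incrementCoeff ℓ k).re ≤ -ℓ ^ 2 := by
  have hn0 : (0 : ℝ) < n := by exact_mod_cast hn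
  have hk0 : (0 : ℝ) < k := by exact_mod_cast hk
  have hpi4 := Real.pi_lt_four
  have hpi3 := Real.pi_gt_three
  have h0 : ∀ r : ℕ, (0 : ℝ) < r → 16 * (r : ℝ) ^ 2 * ℓ ≤ 1 →
      0 < 2 * π * ((r ^ 2 : ℕ) : ℝ) * ℓ ∧ 2 * π * ((r ^ 2 : ℕ) : ℝ) * ℓ ≤ 1 / 2 := by
    intro r hr h
    push_cast
    have : 0 < (r : ℝ) ^ 2 * ℓ := by positivity
    constructor
    · positivity
    · nlinarith
  obtain ⟨h1, h2⟩ := h0 n hn0 hn'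
  obtain ⟨h3, h4⟩ := h0 k hk0 hk'
  have h := re_exp_sub_one_mul_exp_sub_one_le h1 h2 h3 h4
  have h5 : incrementCoeff ℓ n * incrementCoeff ℓ k =
      (eChar (n ^ 2) ℓ - 1) * (eChar (k ^ 2) ℓ - 1) / (((n : ℝ) ^ 2 * (k : ℝ) ^ 2 : ℝ) : ℂ) := by
    rw [incrementCoeff, incrementCoeff, div_mul_div_comm]
    push_cast
    rfl
  rw [h5, Complex.div_ofReal_re, div_le_iff₀ (by positivity), eChar_eq_exp_I_mul,
    eChar_eq_exp_I_mul]
  refine h.trans ?_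
  push_cast
  have h6 : 0 < ℓ ^ 2 * ((n : ℝ) ^ 2 * (k : ℝ) ^ 2) := by positivity
  nlinarith [mul_pos h6 (by nlinarith : 0 < π ^ 2 - 8)]

end IncrementSeries

section StructureFunctionBounds

open Finset Filter Topology

lemma squareReps_subset {M N m : ℕ} (h : m ≤ N ^ 2) : squareReps M m ⊆ squareReps N m := by
  intro p hp
  simp only [squareReps, mem_filter, mem_product, mem_Icc] at hp ⊢
  obtain ⟨⟨⟨h1, -⟩, h2, -⟩, rfl⟩ := hp
  exact ⟨⟨⟨h1, by nlinarith⟩, h2, by nlinarith⟩, rfl⟩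

lemma squareReps_mono {M N : ℕ} (h : M ≤ N) (m : ℕ) : squareReps M m ⊆ squareReps N m := by
  intro p hp
  simp only [squareReps, mem_filter, mem_product, mem_Icc] at hp ⊢
  omega

lemma integral_partialSum_pow_four (ℓ : ℝ) (K : ℕ) :
    ∫ x in (0 : ℝ)..1, ‖∑ n ∈ Icc 1 K, incrementCoeff ℓ n * eChar (n ^ 2) x‖ ^ 4 =
      ∑ m ∈ range (2 * K ^ 2 + 1),
        ‖∑ p ∈ squareReps K m, incrementCoeff ℓ p.1 * incrementCoeff ℓ p.2‖ ^ 2 := by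
  refine integral_norm_pow_four_sum_mul_eChar_sq _ _ _ fun p hp => ?_
  simp only [mem_product, mem_Icc] at hp
  obtain ⟨⟨-, h1⟩, -, h2⟩ := hp
  rw [mem_range]
  nlinarith [Nat.pow_le_pow_left h1 2, Nat.pow_le_pow_left h2 2]

lemma norm_incrementCoeff_mul_le {ℓ : ℝ} (hℓ : 0 ≤ ℓ) {n k : ℕ} (hn : 0 < n) :
    ‖incrementCoeff ℓ n * incrementCoeff ℓ k‖ ≤ 32 * ℓ / ((n : ℝ) ^ 2 + (k : ℝ) ^ 2) := by
  have hn0 : (0 : ℝ) < n := by exact_mod_cast hn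
  rw [norm_mul]
  rcases le_total n k with h | h
  · have hnk : (n : ℝ) ≤ k := by exact_mod_cast h
    have hk0 : (0 : ℝ) < k := hn0.trans_le hnk
    calc _ ≤ (8 * ℓ) * (2 / (k : ℝ) ^ 2) := by
          gcongr
          · exact norm_incrementCoeff_le_mul hℓ n
          · exact norm_incrementCoeff_le ℓ k
      _ = 32 * ℓ / ((k : ℝ) ^ 2 + (k : ℝ) ^ 2) := by field_simp; ring
      _ ≤ _ := by gcongr
  · have hnk : (k : ℝ) ≤ n := by exact_mod_cast h
    calc _ ≤ (2 / (n : ℝ) ^ 2) * (8 * ℓ) := by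
          gcongr
          · exact norm_incrementCoeff_le ℓ n
          · exact norm_incrementCoeff_le_mul hℓ k
      _ = 32 * ℓ / ((n : ℝ) ^ 2 + (n : ℝ) ^ 2) := by field_simp; ring
      _ ≤ _ := by gcongr

lemma exists_scale_norm_sum_squareReps_le {ℓ : ℝ} (hℓ : 0 < ℓ) {N : ℕ}
    (hN : 1 ≤ ℓ * (N : ℝ) ^ 2) (K m : ℕ) :
    ∃ i ≤ m, ‖∑ p ∈ squareReps K m, incrementCoeff ℓ p.1 * incrementCoeff ℓ p.2‖ ≤
      128 * ℓ ^ 2 / 4 ^ i * #(squareReps (2 ^ i * N) m) := by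
  have hN0 : 1 ≤ N ^ 2 := by
    rcases Nat.eq_zero_or_pos N with h | h
    · simp [h] at hN
      linarith
    · exact Nat.pow_pos h
  have hex : ∃ i, m ≤ 4 ^ i * N ^ 2 :=
    ⟨m, (Nat.lt_pow_self (by norm_num : 1 < 4)).le.trans (Nat.le_mul_of_pos_right _ hN0)⟩
  classical
  refine ⟨Nat.find hex, Nat.find_min' hex
    ((Nat.lt_pow_self (by norm_num : 1 < 4)).le.trans (Nat.le_mul_of_pos_right _ hN0)), ?_⟩
  have hi := Nat.find_spec hex
  have hmin : ∀ j < Nat.find hex, ¬ m ≤ 4 ^ j * N ^ 2 := fun j hj => Nat.find_min hex hj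
  generalize Nat.find hex = i at hi hmin
  have hterm : ∀ p ∈ squareReps K m, ‖incrementCoeff ℓ p.1 * incrementCoeff ℓ p.2‖ ≤
      128 * ℓ ^ 2 / 4 ^ i := by
    intro p hp
    simp only [squareReps, mem_filter, mem_product, mem_Icc] at hp
    obtain ⟨⟨⟨h1, -⟩, h2, -⟩, hpm⟩ := hp
    cases i with
    | zero =>
      rw [norm_mul]
      calc _ ≤ (8 * ℓ) * (8 * ℓ) := by
            gcongr
            · exact norm_incrementCoeff_le_mul hℓ.le _
            · exact norm_incrementCoeff_le_mul hℓ.le _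
        _ ≤ _ := by nlinarith [sq_nonneg ℓ]
    | succ j =>
      refine (norm_incrementCoeff_mul_le hℓ.le h1).trans ?_
      have hm : (4 : ℝ) ^ j * (N : ℝ) ^ 2 ≤ (p.1 : ℝ) ^ 2 + (p.2 : ℝ) ^ 2 := by
        have := hmin j (by omega)
        rw [← hpm] at this
        exact_mod_cast (not_le.1 this).le
      have hm' : (4 : ℝ) ^ j ≤ ℓ * ((p.1 : ℝ) ^ 2 + (p.2 : ℝ) ^ 2) := by
        calc (4 : ℝ) ^ j = 4 ^ j * 1 := by ring
          _ ≤ 4 ^ j * (ℓ * (N : ℝ) ^ 2) := by gcongr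
          _ = ℓ * (4 ^ j * (N : ℝ) ^ 2) := by ring
          _ ≤ _ := by gcongr
      have hp1 : (0 : ℝ) < p.1 := by exact_mod_cast h1
      rw [div_le_div_iff₀ (by positivity) (by positivity), pow_succ]
      calc 32 * ℓ * (4 ^ j * 4) = 128 * ℓ * 4 ^ j := by ring
        _ ≤ 128 * ℓ * (ℓ * ((p.1 : ℝ) ^ 2 + (p.2 : ℝ) ^ 2)) := by gcongr
        _ = _ := by ring
  have hcard : #(squareReps K m) ≤ #(squareReps (2 ^ i * N) m) := by
    refine card_le_card (squareReps_subset (hi.trans (le_of_eq ?_)))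
    rw [mul_pow, ← pow_mul, mul_comm i, pow_mul]
    norm_num
  calc _ ≤ ∑ p ∈ squareReps K m, 128 * ℓ ^ 2 / 4 ^ i := norm_sum_le_of_le _ hterm
    _ = 128 * ℓ ^ 2 / 4 ^ i * #(squareReps K m) := by rw [sum_const, nsmul_eq_mul, mul_comm]
    _ ≤ _ := by gcongr

lemma integral_partialSum_pow_four_le {ℓ : ℝ} (hℓ : 0 < ℓ) {N : ℕ}
    (hN : 1 ≤ ℓ * (N : ℝ) ^ 2) (K : ℕ) :
    ∫ x in (0 : ℝ)..1, ‖∑ n ∈ Icc 1 K, incrementCoeff ℓ n * eChar (n ^ 2) x‖ ^ 4 ≤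
      1310720 * ℓ ^ 4 * (N : ℝ) ^ 2 * (1 + Real.log N) := by
  have hN0 : 1 ≤ N := by
    rcases Nat.eq_zero_or_pos N with h | h
    · simp [h] at hN
      linarith
    · exact h
  have hN1 : (1 : ℝ) ≤ N := by exact_mod_cast hN0
  have hlogN : 0 ≤ Real.log N := Real.log_nonneg hN1
  rw [integral_partialSum_pow_four]
  set I := range (2 * K ^ 2 + 1)
  have h1 : ∀ m ∈ I, ‖∑ p ∈ squareReps K m, incrementCoeff ℓ p.1 * incrementCoeff ℓ p.2‖ ^ 2 ≤
      ∑ i ∈ I, (128 * ℓ ^ 2 / 4 ^ i) ^ 2 * (#(squareReps (2 ^ i * N) m) : ℝ) ^ 2 := by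
    intro m hm
    obtain ⟨i, him, hi⟩ := exists_scale_norm_sum_squareReps_le hℓ hN K m
    have hiI : i ∈ I := mem_range.2 (him.trans_lt (mem_range.1 hm))
    refine le_trans ?_ (single_le_sum (f := fun i =>
      (128 * ℓ ^ 2 / 4 ^ i) ^ 2 * (#(squareReps (2 ^ i * N) m) : ℝ) ^ 2)
      (fun _ _ => by positivity) hiI)
    rw [← mul_pow]
    gcongr
  refine (sum_le_sum h1).trans ?_
  rw [sum_comm]
  have h2 : ∀ i ∈ I, ∑ m ∈ I, (128 * ℓ ^ 2 / 4 ^ i) ^ 2 * (#(squareReps (2 ^ i * N) m) : ℝ) ^ 2 ≤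
      655360 * ℓ ^ 4 * (N : ℝ) ^ 2 * (1 + Real.log N) * (1 / 2) ^ i := by
    intro i _
    rw [← mul_sum]
    have h3 : ∑ m ∈ I, (#(squareReps (2 ^ i * N) m) : ℝ) ^ 2 ≤ #(squareQuads (2 ^ i * N)) := by
      exact_mod_cast sum_card_squareReps_sq_le (2 ^ i * N) I
    have h4 : (#(squareQuads (2 ^ i * N)) : ℝ) ≤
        40 * ((2 : ℝ) ^ i * N) ^ 2 * (2 ^ i * (1 + Real.log N)) := by
      have h5 := card_squareQuads_le (M := 2 ^ i * N) (Nat.mul_pos (by positivity) hN0)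
      push_cast at h5
      refine h5.trans ?_
      rw [Real.log_mul (by positivity) (by positivity), Real.log_pow]
      gcongr
      have h6 : (i : ℝ) + 1 ≤ 2 ^ i := by exact_mod_cast Nat.lt_two_pow_self
      have h7 : Real.log 2 ≤ 1 := by linarith [Real.log_two_lt_d9]
      have h8 : (i : ℝ) * Real.log 2 ≤ i := by
        simpa using mul_le_mul_of_nonneg_left h7 (Nat.cast_nonneg (α := ℝ) i)
      have h9 : (1 : ℝ) ≤ 2 ^ i := one_le_pow₀ (by norm_num)
      nlinarith
    calc _ ≤ (128 * ℓ ^ 2 / 4 ^ i) ^ 2 * (40 * ((2 : ℝ) ^ i * N) ^ 2 * (2 ^ i * (1 + Real.log N))) := by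
          gcongr
          exact h3.trans h4
      _ = _ := by
          have : (4 : ℝ) ^ i = 2 ^ i * 2 ^ i := by rw [← mul_pow]; norm_num
          rw [this, one_div, inv_pow]
          field_simp
          norm_num
  refine (sum_le_sum h2).trans ?_
  rw [← mul_sum]
  have h3 := sum_geometric_two_le (2 * K ^ 2 + 1)
  have h4 : 0 ≤ 655360 * ℓ ^ 4 * (N : ℝ) ^ 2 * (1 + Real.log N) := by positivity
  calc _ ≤ 655360 * ℓ ^ 4 * (N : ℝ) ^ 2 * (1 + Real.log N) * 2 := by gcongr
    _ = _ := by ring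

lemma le_integral_partialSum_pow_four {ℓ : ℝ} (hℓ : 0 < ℓ) {L : ℕ}
    (hL : 1152 * (L : ℝ) ^ 2 * ℓ ≤ 1) {K : ℕ} (hK : 6 * L ≤ K) :
    ℓ ^ 4 * ((L : ℝ) ^ 2 * Real.log (L + 1) / 8) ≤
      ∫ x in (0 : ℝ)..1, ‖∑ n ∈ Icc 1 K, incrementCoeff ℓ n * eChar (n ^ 2) x‖ ^ 4 := by
  rw [integral_partialSum_pow_four]
  have h1 : ∀ m ∈ range (72 * L ^ 2 + 1), ℓ ^ 4 * (#(squareReps (6 * L) m) : ℝ) ^ 2 ≤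
      ‖∑ p ∈ squareReps K m, incrementCoeff ℓ p.1 * incrementCoeff ℓ p.2‖ ^ 2 := by
    intro m hm
    have hm' : m ≤ 72 * L ^ 2 := by
      rw [mem_range] at hm
      omega
    have h2 : ℓ ^ 2 * #(squareReps K m) ≤
        ‖∑ p ∈ squareReps K m, incrementCoeff ℓ p.1 * incrementCoeff ℓ p.2‖ := by
      refine le_trans ?_ ((neg_le_abs _).trans (Complex.abs_re_le_norm _))
      rw [Complex.re_sum, ← sum_neg_distrib, mul_comm, ← nsmul_eq_mul]
      refine card_nsmul_le_sum _ _ _ fun p hp => ?_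
      simp only [squareReps, mem_filter, mem_product, mem_Icc] at hp
      obtain ⟨⟨⟨h3, -⟩, h4, -⟩, hpm⟩ := hp
      have h5 : (p.1 : ℝ) ^ 2 + (p.2 : ℝ) ^ 2 ≤ 72 * (L : ℝ) ^ 2 := by
        exact_mod_cast hpm.trans_le hm'
      have := re_incrementCoeff_mul_le hℓ h3 h4
        (by nlinarith [sq_nonneg (p.2 : ℝ)]) (by nlinarith [sq_nonneg (p.1 : ℝ)])
      linarith
    calc ℓ ^ 4 * (#(squareReps (6 * L) m) : ℝ) ^ 2
        = (ℓ ^ 2 * #(squareReps (6 * L) m)) ^ 2 := by ring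
      _ ≤ (ℓ ^ 2 * #(squareReps K m)) ^ 2 := by
          gcongr
          exact squareReps_mono hK m
      _ ≤ _ := by gcongr
  have h2 : (∑ m ∈ range (72 * L ^ 2 + 1), (#(squareReps (6 * L) m) : ℝ) ^ 2) =
      #(squareQuads (6 * L)) := by
    have h3 := sum_card_squareReps_sq (6 * L) (range (72 * L ^ 2 + 1))
    rw [filter_true_of_mem] at h3
    · exact_mod_cast h3
    · intro q hq
      simp only [squareQuads, mem_filter, mem_product, mem_Icc] at hq
      obtain ⟨⟨⟨⟨-, h4⟩, -, h5⟩, -⟩, -⟩ := hq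
      rw [mem_range]
      nlinarith [Nat.pow_le_pow_left h4 2, Nat.pow_le_pow_left h5 2]
  calc _ ≤ ℓ ^ 4 * (#(squareQuads (6 * L)) : ℝ) := by
        gcongr
        exact sq_mul_log_le_card_squareQuads L
    _ = ∑ m ∈ range (72 * L ^ 2 + 1), ℓ ^ 4 * (#(squareReps (6 * L) m) : ℝ) ^ 2 := by
        rw [← h2, mul_sum]
    _ ≤ ∑ m ∈ range (72 * L ^ 2 + 1),
          ‖∑ p ∈ squareReps K m, incrementCoeff ℓ p.1 * incrementCoeff ℓ p.2‖ ^ 2 :=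
        sum_le_sum h1
    _ ≤ _ := by
        refine sum_le_sum_of_subset_of_nonneg ?_ fun _ _ _ => by positivity
        refine range_subset_range.2 ?_
        nlinarith [Nat.pow_le_pow_left hK 2]

lemma structureFn_four_le {s : ℝ} (hs : 0 < s) (hs' : s ≤ 1 / 2) :
    structureFn 4 (s ^ 2) ≤ 10485760 * (s ^ 2) ^ 3 * Real.log (s ^ 2)⁻¹ := by
  set N := ⌈s⁻¹⌉₊
  have hN1 : s⁻¹ ≤ N := Nat.le_ceil _
  have hN2 : (N : ℝ) * s ≤ 2 := by
    have h1 : (N : ℝ) < s⁻¹ + 1 := Nat.ceil_lt_add_one (by positivity)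
    have h2 : (N : ℝ) * s ≤ (s⁻¹ + 1) * s := by gcongr
    rw [add_mul, inv_mul_cancel₀ hs.ne'] at h2
    linarith
  have hN0 : (0 : ℝ) < N := (inv_pos.2 hs).trans_le hN1
  have hsN : 1 ≤ s * N := by
    rwa [inv_le_iff_one_le_mul₀' hs] at hN1
  have hlim := le_of_tendsto (tendsto_integral_partialSum_pow_four (s ^ 2))
    (Eventually.of_forall fun K => integral_partialSum_pow_four_le (pow_pos hs 2) (N := N)
      (by nlinarith) K)
  refine hlim.trans ?_
  have hlog1 : Real.log N ≤ Real.log (s ^ 2)⁻¹ := by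
    refine Real.log_le_log hN0 ?_
    rw [le_inv_comm₀ hN0 (by positivity), ← one_div, le_div_iff₀ hN0]
    nlinarith
  have hlog2 : 1 ≤ Real.log (s ^ 2)⁻¹ := by
    rw [Real.le_log_iff_exp_le (by positivity)]
    have h4 : (4 : ℝ) ≤ (s ^ 2)⁻¹ := by
      rw [le_inv_comm₀ (by norm_num) (by positivity)]
      nlinarith
    linarith [Real.exp_one_lt_d9]
  calc 1310720 * (s ^ 2) ^ 4 * (N : ℝ) ^ 2 * (1 + Real.log N)
      = 1310720 * (s ^ 2) ^ 3 * (N * s) ^ 2 * (1 + Real.log N) := by ring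
    _ ≤ 1310720 * (s ^ 2) ^ 3 * 2 ^ 2 * (Real.log (s ^ 2)⁻¹ + Real.log (s ^ 2)⁻¹) := by
        have : 0 ≤ 1 + Real.log N := by
          have : 0 ≤ Real.log N := Real.log_natCast_nonneg N
          linarith
        gcongr
    _ = _ := by ring

lemma le_structureFn_four {s : ℝ} (hs : 0 < s) (hs' : s ≤ 1 / 3600) :
    1 / 460800 * (s ^ 2) ^ 3 * Real.log (s ^ 2)⁻¹ ≤ structureFn 4 (s ^ 2) := by
  set L := ⌊(60 * s)⁻¹⌋₊
  have hL1 : (L : ℝ) ≤ (60 * s)⁻¹ := Nat.floor_le (by positivity)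
  have hL2 : (60 * s)⁻¹ < L + 1 := Nat.lt_floor_add_one _
  have hL3 : L * s ≤ 1 / 60 := by
    rw [← one_div, le_div_iff₀ (by positivity)] at hL1
    linarith
  have hL4 : 1 / 120 ≤ L * s := by
    rw [← one_div, div_lt_iff₀ (by positivity)] at hL2
    nlinarith
  have hlim := ge_of_tendsto (tendsto_integral_partialSum_pow_four (s ^ 2))
    ((eventually_ge_atTop (6 * L)).mono fun K hK =>
      le_integral_partialSum_pow_four (pow_pos hs 2) (L := L)
        (by nlinarith [mul_nonneg (Nat.cast_nonneg (α := ℝ) L) hs.le]) hK)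
  refine le_trans ?_ hlim
  have hlog : Real.log (s ^ 2)⁻¹ / 4 ≤ Real.log (L + 1) := by
    have h1 : Real.log (60 * s)⁻¹ ≤ Real.log (L + 1) := Real.log_le_log (by positivity) hL2.le
    have h2 : Real.log (60 ^ 2) ≤ Real.log s⁻¹ := by
      refine Real.log_le_log (by norm_num) ?_
      rw [le_inv_comm₀ (by norm_num) hs]
      linarith
    rw [Real.log_inv, Real.log_mul (by norm_num) hs.ne'] at h1
    rw [Real.log_pow, Real.log_inv] at h2
    rw [Real.log_inv, Real.log_pow]
    push_cast at h2 ⊢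
    linarith
  have hlog0 : 0 ≤ Real.log (s ^ 2)⁻¹ :=
    Real.log_nonneg ((one_le_inv₀ (by positivity)).2 (by nlinarith))
  calc 1 / 460800 * (s ^ 2) ^ 3 * Real.log (s ^ 2)⁻¹
      = (s ^ 2) ^ 3 * ((1 / 120) ^ 2 * (Real.log (s ^ 2)⁻¹ / 4) / 8) := by ring
    _ ≤ (s ^ 2) ^ 3 * ((L * s) ^ 2 * Real.log (L + 1) / 8) := by gcongr
    _ = _ := by ring

end StructureFunctionBounds

/-- There exist `c, C > 0` and `ℓ₀ ∈ (0,1/2)` such that for every `0 < ℓ < ℓ₀`,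
`c · ℓ³ · log(ℓ⁻¹) ≤ S₄(ℓ) ≤ C · ℓ³ · log(ℓ⁻¹)`. -/
theorem riemann_S4 :
    ∃ c C ℓ₀ : ℝ, 0 < c ∧ 0 < C ∧ 0 < ℓ₀ ∧ ℓ₀ < 1/2 ∧
      ∀ ℓ : ℝ, 0 < ℓ → ℓ < ℓ₀ →
        c * ℓ ^ 3 * Real.log ℓ⁻¹ ≤ structureFn 4 ℓ ∧
        structureFn 4 ℓ ≤ C * ℓ ^ 3 * Real.log ℓ⁻¹ := by
  refine ⟨1 / 460800, 10485760, (1 / 3600) ^ 2, by norm_num, by norm_num, by norm_num,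
    by norm_num, fun ℓ hℓ hℓ' => ?_⟩
  have hs : 0 < Real.sqrt ℓ := Real.sqrt_pos.2 hℓ
  have hs' : Real.sqrt ℓ ≤ 1 / 3600 := Real.sqrt_le_iff.2 ⟨by norm_num, hℓ'.le⟩
  have h1 := le_structureFn_four hs hs'
  have h2 := structureFn_four_le hs (by linarith)
  rw [Real.sq_sqrt hℓ.le] at h1 h2
  exact ⟨h1, h2⟩
end

section
/- There exist constants c, C > 0 and ℓ₀ ∈ (0, 1/2) such that for every ℓ with 0 < ℓ < ℓ₀, the low-pass filtered increment of Riemann's non-differentiable function at frequency cutoff ℓ⁻¹/2 satisfies c · ℓ³ · log(ℓ⁻¹) ≤ ‖I_{≤ℓ⁻¹/2}(ℓ)‖_{L⁴(𝕋)}⁴ ≤ C · ℓ³ · log(ℓ⁻¹). -/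
open Real MeasureTheory

/-- The increment function `I(ℓ)(x) = 2i ∑_{k≥1} (sin(πkℓ)/k) σ_k e^{2πikx}`. -/
noncomputable def increment (ℓ : ℝ) (x : ℝ) : ℂ :=
  2 * Complex.I *
    ∑' k : ℕ, ((Real.sin (Real.pi * k * ℓ) / k * sqIndicator k : ℝ) : ℂ) * eChar k x

/-- The low-pass filtered increment
`I_{≤M}(ℓ)(x) = 2i ∑_{1 ≤ k ≤ M} (sin(πkℓ)/k) σ_k e^{2πikx}`. -/
noncomputable def incrementLow (M ℓ : ℝ) (x : ℝ) : ℂ :=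
  2 * Complex.I *
    ∑' k : ℕ, if 1 ≤ k ∧ (k : ℝ) ≤ M
      then ((Real.sin (Real.pi * k * ℓ) / k * sqIndicator k : ℝ) : ℂ) * eChar k x else 0

/-- The high-pass filtered increment
`I_{>M}(ℓ)(x) = 2i ∑_{k > M} (sin(πkℓ)/k) σ_k e^{2πikx}`. -/
noncomputable def incrementHigh (M ℓ : ℝ) (x : ℝ) : ℂ :=
  2 * Complex.I *
    ∑' k : ℕ, if M < (k : ℝ)
      then ((Real.sin (Real.pi * k * ℓ) / k * sqIndicator k : ℝ) : ℂ) * eChar k x else 0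

theorem sum_totient_mul_div (Y : ℕ) :
    ∑ d ∈ Finset.Icc 1 Y, Nat.totient d * (Y / d) = ∑ n ∈ Finset.Icc 1 Y, n := by
  induction Y with
  | zero => simp
  | succ Y ih =>
    rw [Finset.sum_Icc_succ_top (by omega), Finset.sum_Icc_succ_top (by omega), ← ih]
    have hdiv : ∑ d ∈ (Y + 1).divisors, Nat.totient d = Y + 1 := Nat.sum_totient (Y + 1)
    have hfilter : (Y + 1).divisors = {d ∈ Finset.Icc 1 (Y + 1) | d ∣ Y + 1} := by
      ext d
      simp only [Nat.mem_divisors, Finset.mem_filter, Finset.mem_Icc]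
      constructor
      · rintro ⟨h, -⟩
        exact ⟨⟨Nat.pos_of_dvd_of_pos h (by omega), Nat.le_of_dvd (by omega) h⟩, h⟩
      · rintro ⟨-, h⟩
        exact ⟨h, by omega⟩
    rw [hfilter, Finset.sum_filter, Finset.sum_Icc_succ_top (by omega)] at hdiv
    simp only [dvd_refl, if_true] at hdiv
    simp only [Nat.succ_div, mul_add, Finset.sum_add_distrib, mul_ite, mul_one, mul_zero,
      dvd_refl, if_true, Nat.div_eq_of_lt (Nat.lt_succ_self Y), zero_add, mul_zero]
    omega

theorem half_le_sum_totient_div (Y : ℕ) (hY : 1 ≤ Y) :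
    ((Y : ℝ) + 1) / 2 ≤ ∑ d ∈ Finset.Icc 1 Y, (Nat.totient d : ℝ) / d := by
  have hY' : (0 : ℝ) < Y := by exact_mod_cast hY
  have hsum : ∑ n ∈ Finset.Icc 1 Y, (n : ℝ) = Y * (Y + 1) / 2 := by
    clear hY hY'
    induction Y with
    | zero => simp
    | succ Y ih =>
      rw [Finset.sum_Icc_succ_top (by omega), ih]
      push_cast
      ring
  have h : ∑ n ∈ Finset.Icc 1 Y, (n : ℝ) ≤
      Y * ∑ d ∈ Finset.Icc 1 Y, (Nat.totient d : ℝ) / d := by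
    have h1 : ∑ n ∈ Finset.Icc 1 Y, (n : ℝ) =
        ∑ d ∈ Finset.Icc 1 Y, (Nat.totient d : ℝ) * ((Y / d : ℕ) : ℝ) := by
      have := congrArg (Nat.cast (R := ℝ)) (sum_totient_mul_div Y)
      push_cast at this
      exact this.symm
    rw [h1, Finset.mul_sum]
    refine Finset.sum_le_sum fun d _ => ?_
    calc (Nat.totient d : ℝ) * ((Y / d : ℕ) : ℝ) ≤ Nat.totient d * ((Y : ℝ) / d) := by
          gcongr
          exact Nat.cast_div_le
      _ = _ := by ring
  rw [hsum] at h
  nlinarith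

theorem half_harmonic_le_sum_totient_div_sq (Z : ℕ) :
    (harmonic Z : ℝ) / 2 ≤ ∑ d ∈ Finset.Icc 1 Z, (Nat.totient d : ℝ) / (d : ℝ) ^ 2 := by
  suffices h : (harmonic Z : ℝ) / 2 ≤ ∑ d ∈ Finset.Icc 1 Z, (Nat.totient d : ℝ) / (d : ℝ) ^ 2 -
      (∑ d ∈ Finset.Icc 1 Z, (Nat.totient d : ℝ) / d) / (Z + 1) by
    have : 0 ≤ (∑ d ∈ Finset.Icc 1 Z, (Nat.totient d : ℝ) / d) / (Z + 1) := by positivity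
    linarith
  induction Z with
  | zero => simp
  | succ Z ih =>
    have h := half_le_sum_totient_div (Z + 1) (by omega)
    rw [Finset.sum_Icc_succ_top (by omega)] at h
    rw [harmonic_succ, Finset.sum_Icc_succ_top (by omega), Finset.sum_Icc_succ_top (by omega)]
    push_cast at h ⊢
    set A := ∑ d ∈ Finset.Icc 1 Z, (Nat.totient d : ℝ) / (d : ℝ) ^ 2
    set S := ∑ d ∈ Finset.Icc 1 Z, (Nat.totient d : ℝ) / d
    set t : ℝ := (Nat.totient (Z + 1) : ℝ)
    have hZ : (0 : ℝ) < Z + 1 := by positivity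
    have hZ2 : (0 : ℝ) < Z + 1 + 1 := by positivity
    have key : A + t / (Z + 1) ^ 2 - (S + t / (Z + 1)) / (Z + 1 + 1) =
        A - S / (Z + 1) + (S + t / (Z + 1)) / ((Z + 1) * (Z + 1 + 1)) := by
      field_simp
      ring
    have h2 : ((Z : ℝ) + 1)⁻¹ / 2 ≤ (S + t / (Z + 1)) / ((Z + 1) * (Z + 1 + 1)) := by
      rw [le_div_iff₀ (by positivity)]
      calc ((Z : ℝ) + 1)⁻¹ / 2 * ((Z + 1) * (Z + 1 + 1)) = (Z + 1 + 1) / 2 := by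
            field_simp
        _ ≤ _ := h
    rw [key]
    linarith

/-- Quadruples of positive integers up to `N` with `a² + b² = c² + d²`. -/
def sqQuadruples (N : ℕ) : Finset (ℕ × ℕ × ℕ × ℕ) :=
  {p ∈ Finset.Icc 1 N ×ˢ Finset.Icc 1 N ×ˢ Finset.Icc 1 N ×ˢ Finset.Icc 1 N |
    p.1 ^ 2 + p.2.1 ^ 2 = p.2.2.1 ^ 2 + p.2.2.2 ^ 2}

theorem mem_sqQuadruples {N a b c d : ℕ} : (a, b, c, d) ∈ sqQuadruples N ↔
    ((1 ≤ a ∧ a ≤ N) ∧ (1 ≤ b ∧ b ≤ N) ∧ (1 ≤ c ∧ c ≤ N) ∧ 1 ≤ d ∧ d ≤ N) ∧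
      a ^ 2 + b ^ 2 = c ^ 2 + d ^ 2 := by
  simp [sqQuadruples]

/-- Index set `(m, w, g, h)` with `w ≤ m` and `g m, h m ≤ X`. -/
def ratioIndex (X : ℕ) : Finset (Σ _ : ℕ, ℕ × ℕ × ℕ) :=
  (Finset.Icc 1 X).sigma fun m =>
    Finset.Icc 1 m ×ˢ Finset.Icc 1 (X / m) ×ˢ Finset.Icc 1 (X / m)

theorem card_ratioIndex_le (X : ℕ) :
    ((ratioIndex X).card : ℝ) ≤ (X : ℝ) ^ 2 * (1 + Real.log X) := by
  have h : ((ratioIndex X).card : ℝ) ≤ (X : ℝ) ^ 2 * harmonic X := by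
    rw [ratioIndex, Finset.card_sigma, harmonic_eq_sum_Icc]
    push_cast
    rw [Finset.mul_sum]
    refine Finset.sum_le_sum fun m hm => ?_
    have hm0 : (0 : ℝ) < m := by exact_mod_cast (Finset.mem_Icc.1 hm).1
    simp only [Finset.card_product, Nat.card_Icc, Nat.add_sub_cancel]
    have hdiv : ((X / m : ℕ) : ℝ) ≤ (X : ℝ) / m := Nat.cast_div_le
    calc ((m * ((X / m) * (X / m)) : ℕ) : ℝ) = m * (((X / m : ℕ) : ℝ) * ((X / m : ℕ) : ℝ)) := by
          push_cast; ring
      _ ≤ m * (((X : ℝ) / m) * ((X : ℝ) / m)) := by gcongr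
      _ = (X : ℝ) ^ 2 * (m : ℝ)⁻¹ := by field_simp
  exact h.trans (by gcongr; exact harmonic_le_one_add_log X)

/-- The quadruple `(a, b, c, d)` with `a - c = g u`, `a + c = h v`, `d - b = g v`, `d + b = h u`. -/
def ratioQuadruple (u v g h : ℕ) : ℕ × ℕ × ℕ × ℕ :=
  ((h * v + g * u) / 2, (h * u - g * v) / 2, (h * v - g * u) / 2, (h * u + g * v) / 2)

theorem exists_ratioQuadruple {N a b c d : ℕ} (hmem : (a, b, c, d) ∈ sqQuadruples N)
    (hca : c < a) : ∃ u v g h : ℕ, 1 ≤ u ∧ 1 ≤ v ∧ 1 ≤ g ∧ 1 ≤ h ∧ g * u ≤ 2 * N ∧ g * v ≤ 2 * N ∧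
      h * u ≤ 2 * N ∧ h * v ≤ 2 * N ∧ (a, b, c, d) = ratioQuadruple u v g h := by
  obtain ⟨⟨⟨ha, ha'⟩, ⟨hb, hb'⟩, ⟨hc, hc'⟩, hd, hd'⟩, heq⟩ := mem_sqQuadruples.1 hmem
  have hbd : b < d := by
    by_contra! hle
    nlinarith
  obtain ⟨s, rfl⟩ : ∃ s, a = c + s := ⟨a - c, by omega⟩
  obtain ⟨t, rfl⟩ : ∃ t, d = b + t := ⟨d - b, by omega⟩
  have hst : s * (2 * c + s) = t * (2 * b + t) := by nlinarith
  obtain ⟨g, u, v, hg, huv, rfl, rfl⟩ :=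
    Nat.exists_coprime' (m := s) (n := t) (Nat.gcd_pos_of_pos_left _ (by omega))
  have hu : 0 < u := by
    rcases Nat.eq_zero_or_pos u with rfl | h
    · simp at hca
    · exact h
  have hv : 0 < v := by
    rcases Nat.eq_zero_or_pos v with rfl | h
    · simp at hbd
    · exact h
  have h1 : u * (2 * c + u * g) = v * (2 * b + v * g) := by
    apply Nat.eq_of_mul_eq_mul_left hg
    nlinarith
  obtain ⟨h, hh⟩ : v ∣ 2 * c + u * g := huv.symm.dvd_of_dvd_mul_left ⟨_, h1⟩
  have h2 : u * h = 2 * b + v * g := by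
    apply Nat.eq_of_mul_eq_mul_left hv
    rw [← h1, hh]
    ring
  have e1 : h * v = 2 * c + u * g := by rw [hh]; ring
  have e2 : h * u = 2 * b + v * g := by rw [← h2]; ring
  have e3 : g * u = u * g := mul_comm _ _
  have e4 : g * v = v * g := mul_comm _ _
  have hh0 : 1 ≤ h := by
    rcases Nat.eq_zero_or_pos h with rfl | h
    · omega
    · exact h
  refine ⟨u, v, g, h, hu, hv, hg, hh0, by omega, by omega, by omega, by omega, ?_⟩
  simp only [ratioQuadruple, e1, e2, e3, e4, Prod.mk.injEq]
  refine ⟨by omega, by omega, by omega, by omega⟩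

theorem sqQuadruples_subset (N : ℕ) : sqQuadruples N ⊆
    (Finset.Icc 1 N ×ˢ Finset.Icc 1 N).image (fun p => (p.1, p.2, p.1, p.2)) ∪
    ((ratioIndex (2 * N)).image (fun q => ratioQuadruple q.1 q.2.1 q.2.2.1 q.2.2.2) ∪
     (ratioIndex (2 * N)).image (fun q => ratioQuadruple q.2.1 q.1 q.2.2.1 q.2.2.2)) ∪
    (((ratioIndex (2 * N)).image (fun q => ratioQuadruple q.1 q.2.1 q.2.2.1 q.2.2.2) ∪
     (ratioIndex (2 * N)).image (fun q => ratioQuadruple q.2.1 q.1 q.2.2.1 q.2.2.2)).image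
      fun p => (p.2.2.1, p.2.2.2, p.1, p.2.1)) := by
  have main : ∀ a b c d : ℕ, (a, b, c, d) ∈ sqQuadruples N → c < a → (a, b, c, d) ∈
      ((ratioIndex (2 * N)).image (fun q => ratioQuadruple q.1 q.2.1 q.2.2.1 q.2.2.2) ∪
      (ratioIndex (2 * N)).image (fun q => ratioQuadruple q.2.1 q.1 q.2.2.1 q.2.2.2)) := by
    intro a b c d hmem hca
    obtain ⟨u, v, g, h, hu, hv, hg, hh, gu, gv, hhu, hhv, heq⟩ := exists_ratioQuadruple hmem hca
    rw [heq, Finset.mem_union, Finset.mem_image, Finset.mem_image]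
    rcases le_total v u with hvu | huv
    · left
      refine ⟨⟨u, v, g, h⟩, ?_, rfl⟩
      simp only [ratioIndex, Finset.mem_sigma, Finset.mem_product, Finset.mem_Icc,
        Nat.le_div_iff_mul_le hu]
      exact ⟨⟨hu, (Nat.le_mul_of_pos_left u hg).trans gu⟩, ⟨hv, hvu⟩, ⟨hg, gu⟩, hh, hhu⟩
    · right
      refine ⟨⟨v, u, g, h⟩, ?_, rfl⟩
      simp only [ratioIndex, Finset.mem_sigma, Finset.mem_product, Finset.mem_Icc,
        Nat.le_div_iff_mul_le hv]
      exact ⟨⟨hv, (Nat.le_mul_of_pos_left v hg).trans gv⟩, ⟨hu, huv⟩, ⟨hg, gv⟩, hh, hhv⟩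
  rintro ⟨a, b, c, d⟩ hmem
  obtain ⟨⟨ha, hb, hc, hd⟩, heq⟩ := mem_sqQuadruples.1 hmem
  rcases lt_trichotomy c a with h | h | h
  · exact Finset.mem_union_left _ (Finset.mem_union_right _ (main a b c d hmem h))
  · refine Finset.mem_union_left _ (Finset.mem_union_left _ (Finset.mem_image.2 ⟨(a, b), ?_, ?_⟩))
    · simp [ha, hb]
    · subst h
      have : b = d := by
        have : b ^ 2 = d ^ 2 := by omega
        exact Nat.pow_left_injective two_ne_zero this
      simp [this]
  · exact Finset.mem_union_right _ (Finset.mem_image.2 ⟨(c, d, a, b),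
      main c d a b (mem_sqQuadruples.2 ⟨⟨hc, hd, ha, hb⟩, heq.symm⟩) h, rfl⟩)

theorem card_sqQuadruples_le (N : ℕ) : ((sqQuadruples N).card : ℝ) ≤
    (N : ℝ) ^ 2 * (17 + 16 * Real.log (2 * N)) := by
  have h1 : (sqQuadruples N).card ≤ N * N + 4 * (ratioIndex (2 * N)).card := by
    refine (Finset.card_le_card (sqQuadruples_subset N)).trans ?_
    set A := (ratioIndex (2 * N)).image (fun q => ratioQuadruple q.1 q.2.1 q.2.2.1 q.2.2.2)
    set B := (ratioIndex (2 * N)).image (fun q => ratioQuadruple q.2.1 q.1 q.2.2.1 q.2.2.2)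
    have hA : A.card ≤ (ratioIndex (2 * N)).card := Finset.card_image_le
    have hB : B.card ≤ (ratioIndex (2 * N)).card := Finset.card_image_le
    have hAB : (A ∪ B).card ≤ A.card + B.card := Finset.card_union_le _ _
    have hD : ((Finset.Icc 1 N ×ˢ Finset.Icc 1 N).image
        (fun p : ℕ × ℕ => (p.1, p.2, p.1, p.2))).card ≤ N * N := by
      refine Finset.card_image_le.trans ?_
      simp
    refine (Finset.card_union_le _ _).trans ?_
    refine (add_le_add (Finset.card_union_le _ _) Finset.card_image_le).trans ?_
    omega
  have h2 := card_ratioIndex_le (2 * N)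
  have h3 : ((sqQuadruples N).card : ℝ) ≤ N * N + 4 * (ratioIndex (2 * N)).card := by
    exact_mod_cast h1
  push_cast at h2
  nlinarith

/-- Index set `(m, j, g, h)` with `j ≤ m` coprime to `m`, `g ≤ K` and `2 K < h ≤ 3 K`, where
`K = ⌊N / (8 m)⌋`. -/
def coprimeIndex (N : ℕ) : Finset (Σ _ : ℕ, ℕ × ℕ × ℕ) :=
  (Finset.Icc 1 (N / 8)).sigma fun m =>
    {j ∈ Finset.Icc 1 m | m.Coprime j} ×ˢ Finset.Icc 1 (N / (8 * m)) ×ˢ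
      Finset.Ioc (2 * (N / (8 * m))) (3 * (N / (8 * m)))

theorem le_card_coprimeIndex (N : ℕ) (hN : 8 ≤ N) :
    (N : ℝ) ^ 2 / 512 * Real.log (N / 8) ≤ ((coprimeIndex N).card : ℝ) := by
  have hlog : Real.log (N / 8) ≤ harmonic (N / 8) := by
    refine (Real.log_le_log (by positivity) ?_).trans (log_add_one_le_harmonic (N / 8))
    have : (N : ℝ) < 8 * ((N / 8 : ℕ) + 1) := by
      have : N < 8 * (N / 8 + 1) := by omega
      exact_mod_cast this
    push_cast
    linarith
  have hφ := half_harmonic_le_sum_totient_div_sq (N / 8)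
  calc (N : ℝ) ^ 2 / 512 * Real.log (N / 8)
      ≤ (N : ℝ) ^ 2 / 256 * ∑ d ∈ Finset.Icc 1 (N / 8), (Nat.totient d : ℝ) / (d : ℝ) ^ 2 := by
        have : (N : ℝ) ^ 2 / 512 * Real.log (N / 8) = (N : ℝ) ^ 2 / 256 * (Real.log (N / 8) / 2) := by
          ring
        rw [this]
        gcongr
        linarith
    _ ≤ ((coprimeIndex N).card : ℝ) := by
        rw [coprimeIndex, Finset.card_sigma]
        push_cast
        rw [Finset.mul_sum]
        refine Finset.sum_le_sum fun m hm => ?_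
        obtain ⟨hm1, hm2⟩ := Finset.mem_Icc.1 hm
        have hm0 : (0 : ℝ) < m := by exact_mod_cast hm1
        have hK : 1 ≤ N / (8 * m) := by
          rw [Nat.le_div_iff_mul_le (by omega)]
          omega
        have hK2 : N < 8 * m * (N / (8 * m) + 1) := Nat.lt_mul_div_succ N (by omega)
        have hK3 : N ≤ 16 * m * (N / (8 * m)) := by nlinarith
        have hK4 : (N : ℝ) / (16 * m) ≤ ((N / (8 * m) : ℕ) : ℝ) := by
          rw [div_le_iff₀ (by positivity)]
          have : (N : ℝ) ≤ 16 * m * ((N / (8 * m) : ℕ) : ℝ) := by exact_mod_cast hK3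
          linarith
        have hcard : ({j ∈ Finset.Icc 1 m | m.Coprime j}).card = Nat.totient m := by
          have := Nat.filter_coprime_Ico_eq_totient m 1
          rwa [show Finset.Ico 1 (1 + m) = Finset.Icc 1 m by ext; simp; omega] at this
        simp only [Finset.card_product, Nat.card_Icc, Nat.card_Ioc, hcard, Nat.add_sub_cancel]
        rw [show 3 * (N / (8 * m)) - 2 * (N / (8 * m)) = N / (8 * m) by omega]
        calc (N : ℝ) ^ 2 / 256 * ((Nat.totient m : ℝ) / (m : ℝ) ^ 2)
            = Nat.totient m * ((N : ℝ) / (16 * m) * ((N : ℝ) / (16 * m))) := by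
              field_simp
              ring
          _ ≤ Nat.totient m * (((N / (8 * m) : ℕ) : ℝ) * ((N / (8 * m) : ℕ) : ℝ)) := by gcongr
          _ = _ := by push_cast; ring

theorem card_coprimeIndex_le (N : ℕ) : (coprimeIndex N).card ≤ (sqQuadruples N).card := by
  refine Finset.card_le_card_of_injOn
    (fun q => ratioQuadruple q.1 (q.1 + q.2.1) (2 * q.2.2.1) (2 * q.2.2.2)) ?_ ?_
  · rintro ⟨m, j, g, h⟩ hq
    simp only [coprimeIndex, Finset.coe_sigma, Set.mem_sigma_iff, Finset.mem_coe,
      Finset.mem_product, Finset.mem_filter, Finset.mem_Icc, Finset.mem_Ioc] at hq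
    obtain ⟨⟨hm, hm'⟩, ⟨⟨hj, hj'⟩, hco⟩, ⟨hg, hg'⟩, hh, hh'⟩ := hq
    have hK : N / (8 * m) * (8 * m) ≤ N := Nat.div_mul_le_self _ _
    set K := N / (8 * m)
    have hgh : 2 * g < h := by omega
    simp only [ratioQuadruple, Finset.mem_coe]
    have e1 : 2 * h * (m + j) = 2 * (h * (m + j)) := by ring
    have e2 : 2 * g * (m + j) = 2 * (g * (m + j)) := by ring
    have e3 : 2 * h * m = 2 * (h * m) := by ring
    have e4 : 2 * g * m = 2 * (g * m) := by ring
    rw [e1, e2, e3, e4, ← mul_add, ← mul_add, ← Nat.mul_sub, ← Nat.mul_sub]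
    simp only [Nat.mul_div_cancel_left _ (zero_lt_two)]
    have l1 : g * m < h * (m + j) := by nlinarith
    have l2 : g * (m + j) < h * m := by nlinarith
    have b1 : h * (m + j) ≤ 3 * K * (2 * m) := Nat.mul_le_mul hh' (by omega)
    have b2 : g * (m + j) ≤ K * (2 * m) := Nat.mul_le_mul hg' (by omega)
    have b3 : h * m ≤ h * (m + j) := Nat.mul_le_mul le_rfl (by omega)
    have b4 : g * m ≤ g * (m + j) := Nat.mul_le_mul le_rfl (by omega)
    have hK' : 3 * K * (2 * m) + K * (2 * m) ≤ N := by
      refine le_trans (le_of_eq ?_) hK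
      ring
    rw [mem_sqQuadruples]
    refine ⟨by omega, ?_⟩
    obtain ⟨r, hr⟩ := Nat.exists_eq_add_of_lt l1
    obtain ⟨t, ht⟩ := Nat.exists_eq_add_of_lt l2
    have r1 : h * (m + j) - g * m = r + 1 := by omega
    have r2 : h * m - g * (m + j) = t + 1 := by omega
    rw [r1, r2]
    zify at hr ht ⊢
    have r3 : (r : ℤ) + 1 = h * (m + j) - g * m := by linarith
    have r4 : (t : ℤ) + 1 = h * m - g * (m + j) := by linarith
    rw [r3, r4]
    ring
  · rintro ⟨m, j, g, h⟩ hq ⟨m', j', g', h'⟩ hq' heq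
    simp only [coprimeIndex, Finset.coe_sigma, Set.mem_sigma_iff, Finset.mem_coe,
      Finset.mem_product, Finset.mem_filter, Finset.mem_Icc, Finset.mem_Ioc] at hq hq'
    obtain ⟨⟨hm, -⟩, ⟨⟨hj, hj'⟩, hco⟩, ⟨hg, hg'⟩, hh, -⟩ := hq
    obtain ⟨⟨hm2, -⟩, ⟨⟨hj2, hj2'⟩, hco2⟩, ⟨hg2, hg2'⟩, hh2, -⟩ := hq'
    have hgh : 2 * g < h := by omega
    have hgh2 : 2 * g' < h' := by omega
    have l1 : g * m < h * (m + j) := by nlinarith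
    have l2 : g * (m + j) < h * m := by nlinarith
    have l3 : g' * m' < h' * (m' + j') := by nlinarith
    have l4 : g' * (m' + j') < h' * m' := by nlinarith
    simp only [ratioQuadruple, Prod.mk.injEq, mul_assoc, ← mul_add, ← Nat.mul_sub,
      Nat.mul_div_cancel_left _ (zero_lt_two)] at heq
    obtain ⟨q1, q2, q3, q4⟩ := heq
    have s1 : g * m = g' * m' := by omega
    have s2 : g * (m + j) = g' * (m' + j') := by omega
    have s3 : h * m = h' * m' := by omega
    have hgg : g = g' := by
      have c1 : Nat.gcd (g * m) (g * (m + j)) = g := by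
        rw [Nat.gcd_mul_left, Nat.coprime_self_add_right.2 hco, mul_one]
      have c2 : Nat.gcd (g' * m') (g' * (m' + j')) = g' := by
        rw [Nat.gcd_mul_left, Nat.coprime_self_add_right.2 hco2, mul_one]
      rw [← c1, ← c2, s1, s2]
    subst hgg
    have hmm : m = m' := Nat.eq_of_mul_eq_mul_left hg s1
    subst hmm
    have hjj : j = j' := by
      have := Nat.eq_of_mul_eq_mul_left hg s2
      omega
    subst hjj
    have hhh : h = h' := Nat.eq_of_mul_eq_mul_right hm s3
    subst hhh
    rfl

theorem integral_exp_two_pi_int (k : ℤ) :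
    ∫ x in (0 : ℝ)..1, Complex.exp (2 * π * Complex.I * k * x) = if k = 0 then 1 else 0 := by
  split_ifs with hk
  · simp [hk]
  · have hc : 2 * π * Complex.I * k ≠ 0 := by
      simp [hk, Real.pi_ne_zero]
    rw [integral_exp_mul_complex hc]
    have : 2 * π * Complex.I * k * ((1 : ℝ) : ℂ) = k * (2 * π * Complex.I) := by
      push_cast
      ring
    rw [this, Complex.exp_int_mul_two_pi_mul_I]
    simp

theorem integral_norm_pow_four (s : Finset ℕ) (a : ℕ → ℝ) :
    ∫ x in (0 : ℝ)..1, ‖∑ n ∈ s, (a n : ℂ) * eChar (n ^ 2) x‖ ^ 4 =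
      ∑ p ∈ s ×ˢ s ×ˢ s ×ˢ s with p.1 ^ 2 + p.2.1 ^ 2 = p.2.2.1 ^ 2 + p.2.2.2 ^ 2,
        a p.1 * a p.2.1 * a p.2.2.1 * a p.2.2.2 := by
  have hexpand : ∀ x : ℝ, ((‖∑ n ∈ s, (a n : ℂ) * eChar (n ^ 2) x‖ ^ 4 : ℝ) : ℂ) =
      ∑ p ∈ s ×ˢ s ×ˢ s ×ˢ s, ((a p.1 * a p.2.1 * a p.2.2.1 * a p.2.2.2 : ℝ) : ℂ) *
        Complex.exp (2 * π * Complex.I *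
          (((p.1 : ℤ) ^ 2 + (p.2.1 : ℤ) ^ 2 - (p.2.2.1 : ℤ) ^ 2 - (p.2.2.2 : ℤ) ^ 2 : ℤ) : ℂ) *
            x) := by
    intro x
    have hconj : ∀ k : ℕ, (starRingEnd ℂ) (eChar k x) =
        Complex.exp (-(2 * π * Complex.I * k * x)) := by
      intro k
      rw [eChar, ← Complex.exp_conj]
      simp [Complex.conj_ofNat]
    set f := ∑ n ∈ s, (a n : ℂ) * eChar (n ^ 2) x with hf
    have hnorm : ((‖f‖ ^ 4 : ℝ) : ℂ) = f * (f * ((starRingEnd ℂ) f * (starRingEnd ℂ) f)) := by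
      have := Complex.mul_conj' f
      push_cast
      calc (‖f‖ : ℂ) ^ 4 = ((‖f‖ : ℂ) ^ 2) * ((‖f‖ : ℂ) ^ 2) := by ring
        _ = _ := by rw [← this]; ring
    rw [hnorm, hf, map_sum]
    simp only [map_mul, Complex.conj_ofReal, hconj]
    rw [Finset.sum_mul_sum s s, ← Finset.sum_product', Finset.sum_mul_sum, ← Finset.sum_product',
      Finset.sum_mul_sum, ← Finset.sum_product']
    refine Finset.sum_congr rfl fun p _ => ?_
    have : 2 * π * Complex.I *
          (((p.1 : ℤ) ^ 2 + (p.2.1 : ℤ) ^ 2 - (p.2.2.1 : ℤ) ^ 2 - (p.2.2.2 : ℤ) ^ 2 : ℤ) : ℂ) * x =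
        2 * π * Complex.I * ((p.1 ^ 2 : ℕ) : ℂ) * x + (2 * π * Complex.I * ((p.2.1 ^ 2 : ℕ) : ℂ) * x
        + (-(2 * π * Complex.I * ((p.2.2.1 ^ 2 : ℕ) : ℂ) * x)
        + -(2 * π * Complex.I * ((p.2.2.2 ^ 2 : ℕ) : ℂ) * x))) := by
      push_cast
      ring
    rw [this, Complex.exp_add, Complex.exp_add, Complex.exp_add, eChar, eChar]
    push_cast
    ring
  apply Complex.ofReal_injective
  rw [← intervalIntegral.integral_ofReal]
  simp_rw [hexpand]
  rw [intervalIntegral.integral_finsetSum]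
  · simp_rw [intervalIntegral.integral_const_mul, integral_exp_two_pi_int]
    rw [Finset.sum_filter, Complex.ofReal_sum]
    refine Finset.sum_congr rfl fun p _ => ?_
    have : ((p.1 : ℤ) ^ 2 + (p.2.1 : ℤ) ^ 2 - (p.2.2.1 : ℤ) ^ 2 - (p.2.2.2 : ℤ) ^ 2 = 0) ↔
        p.1 ^ 2 + p.2.1 ^ 2 = p.2.2.1 ^ 2 + p.2.2.2 ^ 2 := by
      zify
      constructor <;> intro h <;> linarith
    simp only [this]
    split_ifs <;> simp
  · intro p _
    apply Continuous.intervalIntegrable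
    fun_prop

theorem incrementLow_eq_sum {M : ℝ} (hM : 0 ≤ M) (ℓ x : ℝ) :
    incrementLow M ℓ x = 2 * Complex.I * ∑ n ∈ Finset.Icc 1 (Nat.sqrt ⌊M⌋₊),
      ((Real.sin (π * (n : ℝ) ^ 2 * ℓ) / (n : ℝ) ^ 2 : ℝ) : ℂ) * eChar (n ^ 2) x := by
  have hmem : ∀ n : ℕ, n ≤ Nat.sqrt ⌊M⌋₊ ↔ ((n * n : ℕ) : ℝ) ≤ M := fun n => by
    rw [Nat.le_sqrt, Nat.le_floor_iff hM]
  rw [incrementLow, tsum_eq_sum (s := (Finset.Icc 1 (Nat.sqrt ⌊M⌋₊)).image (· ^ 2)),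
    Finset.sum_image]
  · congr 1
    refine Finset.sum_congr rfl fun n hn => ?_
    obtain ⟨h1, h2⟩ := Finset.mem_Icc.1 hn
    have h3 := (hmem n).1 h2
    rw [if_pos ⟨Nat.one_le_pow _ _ h1, by rwa [pow_two]⟩]
    have : sqIndicator (n ^ 2) = 1 := if_pos (IsSquare.sq n)
    rw [this]
    push_cast
    simp
  · intro a _ b _ h
    exact Nat.pow_left_injective two_ne_zero h
  · intro k hk
    split_ifs with h
    · have hsq : ¬ IsSquare k := by
        rintro ⟨r, rfl⟩
        apply hk
        refine Finset.mem_image.2 ⟨r, Finset.mem_Icc.2 ⟨?_, (hmem r).2 h.2⟩, pow_two r⟩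
        exact Nat.pos_of_mul_pos_left h.1
      simp [sqIndicator, hsq]
    · rfl

theorem two_mul_le_sin_div {ℓ t : ℝ} (ht : 0 < t) (hℓ : 0 ≤ ℓ) (h : t * ℓ ≤ 1 / 2) :
    2 * ℓ ≤ Real.sin (π * t * ℓ) / t := by
  rw [le_div_iff₀ ht]
  have := Real.mul_le_sin (x := π * t * ℓ) (by positivity) (by nlinarith [Real.pi_pos])
  refine le_trans (le_of_eq ?_) this
  field_simp

theorem sin_div_le {ℓ t : ℝ} (ht : 0 < t) (hℓ : 0 ≤ ℓ) :
    Real.sin (π * t * ℓ) / t ≤ π * ℓ := by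
  rw [div_le_iff₀ ht]
  have := Real.sin_le (x := π * t * ℓ) (by positivity)
  linarith

/-- There exist `c, C > 0` and `ℓ₀ ∈ (0,1/2)` such that for every `0 < ℓ < ℓ₀`,
`c · ℓ³ · log(ℓ⁻¹) ≤ ‖I_{≤ℓ⁻¹/2}(ℓ)‖_{L⁴(𝕋)}⁴ ≤ C · ℓ³ · log(ℓ⁻¹)`. -/
theorem riemann_increment_low_L4 :
    ∃ c C ℓ₀ : ℝ, 0 < c ∧ 0 < C ∧ 0 < ℓ₀ ∧ ℓ₀ < 1/2 ∧
      ∀ ℓ : ℝ, 0 < ℓ → ℓ < ℓ₀ →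
        c * ℓ ^ 3 * Real.log ℓ⁻¹ ≤
          (∫ x in (0:ℝ)..1, ‖incrementLow (ℓ⁻¹ / 2) ℓ x‖ ^ 4) ∧
        (∫ x in (0:ℝ)..1, ‖incrementLow (ℓ⁻¹ / 2) ℓ x‖ ^ 4) ≤
          C * ℓ ^ 3 * Real.log ℓ⁻¹ := by
  refine ⟨1 / 64, 264 * π ^ 4, 1 / 300000, by norm_num, by positivity, by norm_num, by norm_num,
    fun ℓ hℓ hℓ' => ?_⟩
  set y : ℝ := ℓ⁻¹ with hy
  have hy0 : 0 < y := inv_pos.2 hℓ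
  have hyℓ : ℓ * y = 1 := mul_inv_cancel₀ hℓ.ne'
  have hy1 : 300000 < y := by
    rw [hy, lt_inv_comm₀ (by norm_num) hℓ]
    simpa using hℓ'
  set N := Nat.sqrt ⌊y / 2⌋₊ with hN
  have hNle : (N : ℝ) ^ 2 ≤ y / 2 := by
    have h : N * N ≤ ⌊y / 2⌋₊ := Nat.sqrt_le _
    have h' := (Nat.le_floor_iff (by positivity)).1 h
    push_cast at h'
    linarith
  have hNlt : y / 2 < ((N : ℝ) + 1) ^ 2 := by
    have h : ⌊y / 2⌋₊ < (N + 1) * (N + 1) := Nat.lt_succ_sqrt _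
    have h' := (Nat.floor_lt (by positivity)).1 h
    push_cast at h'
    linarith
  have hN8 : (8 : ℝ) ≤ N := by
    by_contra! h
    nlinarith [Nat.cast_nonneg (α := ℝ) N]
  have hNge : y / 8 ≤ (N : ℝ) ^ 2 := by nlinarith
  have hlog1 : 1 ≤ Real.log y := by
    rw [Real.le_log_iff_exp_le hy0]
    linarith [Real.exp_one_lt_d9]
  set a : ℕ → ℝ := fun n => Real.sin (π * (n : ℝ) ^ 2 * ℓ) / (n : ℝ) ^ 2 with ha
  have hint : ∫ x in (0 : ℝ)..1, ‖incrementLow (y / 2) ℓ x‖ ^ 4 =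
      16 * ∑ p ∈ sqQuadruples N, a p.1 * a p.2.1 * a p.2.2.1 * a p.2.2.2 := by
    rw [sqQuadruples, ← integral_norm_pow_four, ← intervalIntegral.integral_const_mul]
    refine intervalIntegral.integral_congr fun x _ => ?_
    simp only [incrementLow_eq_sum (show 0 ≤ y / 2 by positivity), norm_mul, mul_pow, ha, hN]
    norm_num
  have hbound : ∀ n ∈ Finset.Icc 1 N, 2 * ℓ ≤ a n ∧ a n ≤ π * ℓ := by
    intro n hn
    obtain ⟨h1, h2⟩ := Finset.mem_Icc.1 hn
    have h1' : (0 : ℝ) < (n : ℝ) ^ 2 := by positivity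
    have h2' : (n : ℝ) ^ 2 ≤ (N : ℝ) ^ 2 := by gcongr
    refine ⟨two_mul_le_sin_div h1' hℓ.le ?_, sin_div_le h1' hℓ.le⟩
    nlinarith
  have hterm : ∀ p ∈ sqQuadruples N, (2 * ℓ) ^ 4 ≤ a p.1 * a p.2.1 * a p.2.2.1 * a p.2.2.2 ∧
      a p.1 * a p.2.1 * a p.2.2.1 * a p.2.2.2 ≤ (π * ℓ) ^ 4 := by
    intro p hp
    simp only [sqQuadruples, Finset.mem_filter, Finset.mem_product] at hp
    obtain ⟨⟨h1, h2, h3, h4⟩, -⟩ := hp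
    obtain ⟨l1, u1⟩ := hbound _ h1
    obtain ⟨l2, u2⟩ := hbound _ h2
    obtain ⟨l3, u3⟩ := hbound _ h3
    obtain ⟨l4, u4⟩ := hbound _ h4
    have p1 : 0 ≤ a p.1 := by linarith
    have p2 : 0 ≤ a p.2.1 := by linarith
    have p3 : 0 ≤ a p.2.2.1 := by linarith
    have p4 : 0 ≤ a p.2.2.2 := by linarith
    constructor
    · calc (2 * ℓ) ^ 4 = 2 * ℓ * (2 * ℓ) * (2 * ℓ) * (2 * ℓ) := by ring
        _ ≤ _ := by gcongr
    · calc _ ≤ π * ℓ * (π * ℓ) * (π * ℓ) * (π * ℓ) := by gcongr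
        _ = _ := by ring
  have hlower := Finset.card_nsmul_le_sum _ _ _ fun p hp => (hterm p hp).1
  have hupper := Finset.sum_le_card_nsmul _ _ _ fun p hp => (hterm p hp).2
  rw [nsmul_eq_mul] at hlower hupper
  rw [hint]
  constructor
  · have hcard : (N : ℝ) ^ 2 / 512 * Real.log (N / 8) ≤ ((sqQuadruples N).card : ℝ) :=
      (le_card_coprimeIndex N (by exact_mod_cast hN8)).trans
        (by exact_mod_cast card_coprimeIndex_le N)
    have hlog : Real.log y ≤ 4 * Real.log (N / 8) := by
      rw [show (4 : ℝ) * Real.log (N / 8) = Real.log (((N : ℝ) / 8) ^ 4) by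
        rw [Real.log_pow]; norm_num]
      refine Real.log_le_log hy0 ?_
      have : (y / 8) ^ 2 ≤ ((N : ℝ) ^ 2) ^ 2 := by gcongr
      nlinarith
    have hcard2 : y / 8 / 512 * (Real.log y / 4) ≤ ((sqQuadruples N).card : ℝ) := by
      refine le_trans ?_ hcard
      gcongr
      linarith
    calc 1 / 64 * ℓ ^ 3 * Real.log y
        = 16 * (y / 8 / 512 * (Real.log y / 4) * (2 * ℓ) ^ 4) := by
          linear_combination (-(1 / 64) * ℓ ^ 3 * Real.log y) * hyℓ
      _ ≤ 16 * ((sqQuadruples N).card * (2 * ℓ) ^ 4) := by gcongr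
      _ ≤ _ := by gcongr
  · have hlog : Real.log (2 * N) ≤ Real.log y := by
      refine Real.log_le_log (by positivity) ?_
      nlinarith
    have hcard : ((sqQuadruples N).card : ℝ) ≤ y / 2 * (33 * Real.log y) := by
      refine (card_sqQuadruples_le N).trans ?_
      have hpos : 0 ≤ Real.log (2 * N) := Real.log_nonneg (by linarith)
      gcongr
      linarith
    calc 16 * ∑ p ∈ sqQuadruples N, a p.1 * a p.2.1 * a p.2.2.1 * a p.2.2.2
        ≤ 16 * ((sqQuadruples N).card * (π * ℓ) ^ 4) := by gcongr
      _ ≤ 16 * (y / 2 * (33 * Real.log y) * (π * ℓ) ^ 4) := by gcongr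
      _ = 264 * π ^ 4 * ℓ ^ 3 * Real.log y := by
          linear_combination (264 * π ^ 4 * ℓ ^ 3 * Real.log y) * hyℓ
end
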